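/- arXiv:cs/0102007 — 2 statements merged into one kernel-verified Lean document; each statement's English description precedes it below -/
import Mathlib

section
/- Let φ be a CNF formula over variables x₁,…,x_n with n ≥ 2 and clauses C₁,…,C_m with m ≥ 1. Then in every plane embedding Φ of G_φ: (1) the cycle c₁,…,c_m,u_n,u₀ forms the boundary of some face F of Φ (that is, the frontier of F is exactly the union of the arcs of the edges {u₀,c₁}, {c₁,c₂},…,{c_{m−1},c_m}, {c_m,u_n}, {u_n,u₀}); (2) there is exactly one face F′ ≠ F of Φ whose boundary contains all of the vertices c₁,…,c_m; and (3) for each i ∈ {1,…,n}, exactly one of the two vertices x_i and x̄_i lies on the boundary of F′. -/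
open Set Topology

/-- A plane embedding of a simple graph `G`: an injective placement of the vertices in the
plane together with, for each edge, an arc (the image of an injective continuous path) whose
endpoints are the images of the endpoints of the edge, such that two distinct arcs intersect
only in images of common endpoints and an arc meets the image of a vertex only if that vertex
is an endpoint of the corresponding edge. -/
structure PlaneEmbedding {V : Type*} (G : SimpleGraph V) where
  vmap : V → ℝ × ℝ
  vmap_inj : Function.Injective vmap
  arc : G.edgeSet → Set (ℝ × ℝ)
  arc_path : ∀ e : G.edgeSet, ∃ f : unitInterval → ℝ × ℝ,
    Continuous f ∧ Function.Injective f ∧ Set.range f = arc e ∧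
    ∃ u v : V, (e : Sym2 V) = s(u, v) ∧ f 0 = vmap u ∧ f 1 = vmap v
  arc_inter : ∀ e e' : G.edgeSet, e ≠ e' →
    arc e ∩ arc e' ⊆ vmap '' {x : V | x ∈ (e : Sym2 V) ∧ x ∈ (e' : Sym2 V)}
  vmap_mem_arc : ∀ (e : G.edgeSet) (x : V), vmap x ∈ arc e → x ∈ (e : Sym2 V)

namespace PlaneEmbedding

variable {V : Type*} {G : SimpleGraph V}

/-- The union of all arcs of the embedding. -/
def drawing (Φ : PlaneEmbedding G) : Set (ℝ × ℝ) :=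
  ⋃ e : G.edgeSet, Φ.arc e

/-- The faces of the embedding: connected components of the complement of the drawing. -/
def IsFace (Φ : PlaneEmbedding G) (F : Set (ℝ × ℝ)) : Prop :=
  ∃ p ∈ Φ.drawingᶜ, F = connectedComponentIn Φ.drawingᶜ p

/-- The vertex `v` lies on the boundary of the face `F`. -/
def OnFace (Φ : PlaneEmbedding G) (F : Set (ℝ × ℝ)) (v : V) : Prop :=
  Φ.vmap v ∈ frontier F

/-- The embedding satisfies a family `C` of vertex subsets: some face has on its boundary
at least one vertex from each set in `C`. -/
def SatisfiesFam (Φ : PlaneEmbedding G) (C : Set (Set V)) : Prop :=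
  ∃ F : Set (ℝ × ℝ), Φ.IsFace F ∧ ∀ U ∈ C, ∃ v ∈ U, Φ.OnFace F v

end PlaneEmbedding

/-- A graph is planar if it has a plane embedding. -/
def Planar {V : Type*} (G : SimpleGraph V) : Prop :=
  Nonempty (PlaneEmbedding G)
/-- Vertices of the graph `G_φ`: literal vertices `x_i` (`lit i true`) and `x̄_i`
(`lit i false`), clause vertices `c_j`, and the vertices `u_0, …, u_n`. -/
inductive CNFVtx (n m : ℕ) : Type where
  | lit : Fin n → Bool → CNFVtx n m
  | cl  : Fin m → CNFVtx n m
  | u   : Fin (n + 1) → CNFVtx n m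

/-- The base edge relation of `G_φ`. -/
def cnfRel (n m : ℕ) : CNFVtx n m → CNFVtx n m → Prop := fun a b =>
  (∃ (i : Fin n) (p : Bool), a = CNFVtx.u i.castSucc ∧ b = CNFVtx.lit i p) ∨
  (∃ (i : Fin n) (p : Bool), a = CNFVtx.lit i p ∧ b = CNFVtx.u i.succ) ∨
  (∃ j : Fin m, (j : ℕ) = 0 ∧ a = CNFVtx.u 0 ∧ b = CNFVtx.cl j) ∨
  (∃ j j' : Fin m, (j' : ℕ) = (j : ℕ) + 1 ∧ a = CNFVtx.cl j ∧ b = CNFVtx.cl j') ∨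
  (∃ j : Fin m, (j : ℕ) + 1 = m ∧ a = CNFVtx.cl j ∧ b = CNFVtx.u (Fin.last n)) ∨
  (a = CNFVtx.u (Fin.last n) ∧ b = CNFVtx.u 0)

/-- The simple graph `G_φ` associated with a CNF formula with `n` variables and `m` clauses. -/
def cnfGraph (n m : ℕ) : SimpleGraph (CNFVtx n m) :=
  SimpleGraph.fromRel (cnfRel n m)
/-- The edges of the cycle `c_1, …, c_m, u_n, u_0` in `G_φ`. -/
def cycleEdges (n m : ℕ) : Set (Sym2 (CNFVtx n m)) :=
  {p | ∃ j : Fin m, (j : ℕ) = 0 ∧ p = s(CNFVtx.u 0, CNFVtx.cl j)} ∪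
  {p | ∃ j j' : Fin m, (j' : ℕ) = (j : ℕ) + 1 ∧ p = s(CNFVtx.cl j, CNFVtx.cl j')} ∪
  {p | ∃ j : Fin m, (j : ℕ) + 1 = m ∧ p = s(CNFVtx.cl j, CNFVtx.u (Fin.last n))} ∪
  {s(CNFVtx.u (Fin.last n), CNFVtx.u 0)}

open Set Topology

namespace Pl

lemma lift {X : Type*} [TopologicalSpace X] (H : unitInterval × X → ℂ) (hc : Continuous H)
    (h0 : ∀ p, H p ≠ 0) (h1 : ∀ x, H (0, x) = 1) :
    ∃ L : X → ℂ, Continuous L ∧ ∀ x, Complex.exp (L x) = H (1, x) := by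
  let H' : C(unitInterval × X, {z : ℂ // z ≠ 0}) :=
    ⟨fun p => ⟨H p, h0 p⟩, by fun_prop⟩
  have H0 : ∀ a, H' (0, a) = (⟨_, Complex.exp_ne_zero ((ContinuousMap.const X (0:ℂ)) a)⟩ : {z : ℂ // z ≠ 0}) := by
    intro a
    apply Subtype.ext
    simp [H', h1]
  let G := Complex.isCoveringMap_exp.liftHomotopy H' (ContinuousMap.const X 0) H0
  refine ⟨fun x => G (1, x), by fun_prop, fun x => ?_⟩
  have := congrFun (Complex.isCoveringMap_exp.liftHomotopy_lifts H' (ContinuousMap.const X 0) H0) (1, x)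
  exact congrArg Subtype.val this

lemma exp_const {X : Type*} [TopologicalSpace X] {S : Set X} (hS : IsPreconnected S) {f : X → ℂ}
    (hf : ContinuousOn f S) (h1 : ∀ x ∈ S, Complex.exp (f x) = 1) {x y : X} (hx : x ∈ S)
    (hy : y ∈ S) : f x = f y := by
  have : EqOn f (fun _ => f y) S := by
    refine Complex.isCoveringMap_exp.eqOn_of_comp_eqOn hS hf continuousOn_const ?_ hy rfl
    intro z hz
    apply Subtype.ext
    simp [h1 z hz, h1 y hy]
  exact this hx

/-- no logarithm around a circle -/
lemma circle {H G : ℝ → ℂ} {k : ℤ} (hH : Continuous H) (hG : Continuous G)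
    (h : ∀ t, Complex.exp (H t) = Complex.exp (G t + k * (t * Complex.I)))
    (h0 : H 0 = H (2 * Real.pi)) (g0 : G 0 = G (2 * Real.pi)) : k = 0 := by
  have := exp_const (S := univ) (f := fun t => H t - (G t + k * (t * Complex.I)))
    isPreconnected_univ (by fun_prop) (fun t _ => by
      rw [Complex.exp_sub, h, div_self (Complex.exp_ne_zero _)]) (mem_univ 0) (mem_univ (2 * Real.pi))
  simp only [h0, g0] at this
  have h2 : (k : ℂ) * ((2 * Real.pi) * Complex.I) = 0 := by
    push_cast at this
    linear_combination this
  simpa [Real.pi_ne_zero] using h2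

/-- a nonvanishing function on a plane has a log -/
lemma log_plane {w : ℂ → ℂ} (hw : Continuous w) (h0 : ∀ z, w z ≠ 0) :
    ∃ L : ℂ → ℂ, Continuous L ∧ ∀ z, Complex.exp (L z) = w z := by
  obtain ⟨L, hL, h⟩ := lift (fun p : unitInterval × ℂ => w ((p.1 : ℝ) * p.2) / w 0)
    (by fun_prop (disch := simp [h0])) (fun p => div_ne_zero (h0 _) (h0 _)) (by simp [h0])
  refine ⟨fun z => L z + Complex.log (w 0), by fun_prop, fun z => ?_⟩
  rw [Complex.exp_add, h, Complex.exp_log (h0 _)]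
  simp [h0]

/-- `S` is an arc from `a` to `b`. -/
def IsArc {X : Type*} [TopologicalSpace X] (S : Set X) (a b : X) : Prop :=
  ∃ f : unitInterval → X, Continuous f ∧ Function.Injective f ∧ range f = S ∧ f 0 = a ∧ f 1 = b

def HasLog (K : Set ℂ) (f : ℂ → ℂ) : Prop :=
  ∃ h : ℂ → ℂ, ContinuousOn h K ∧ ∀ z ∈ K, Complex.exp (h z) = f z

lemma arc_log {S : Set ℂ} {a b : ℂ} (hS : IsArc S a b) {f : ℂ → ℂ} (hf : ContinuousOn f S)
    (h0 : ∀ z ∈ S, f z ≠ 0) : HasLog S f := by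
  obtain ⟨g, gc, gi, rfl, -, -⟩ := hS
  have hfg : Continuous (fun t => f (g t)) := hf.comp_continuous gc (fun t => mem_range_self t)
  have h0' : ∀ t, f (g t) ≠ 0 := fun t => h0 _ (mem_range_self t)
  obtain ⟨L, hL, h⟩ := lift (fun p : unitInterval × unitInterval => f (g (p.1 * p.2)) / f (g 0))
    ((hfg.comp (continuous_fst.mul continuous_snd)).div_const _)
    (fun p => div_ne_zero (h0' _) (h0' _)) (by simp [h0'])
  have emb : IsClosedEmbedding g := gc.isClosedEmbedding gi
  let e := emb.isEmbedding.toHomeomorph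
  let L' : C(range g, ℂ) := ⟨fun z => L (e.symm z), by fun_prop⟩
  obtain ⟨h', hh⟩ := ContinuousMap.exists_restrict_eq emb.isClosed_range L'
  have key : ∀ t, h' (g t) = L t := by
    intro t
    have := DFunLike.congr_fun hh ⟨g t, mem_range_self t⟩
    simp only [ContinuousMap.restrict_apply] at this
    rw [this]
    simp only [L', ContinuousMap.coe_mk]
    congr 1
    rw [Homeomorph.symm_apply_eq]
    rfl
  refine ⟨fun z => h' z + Complex.log (f (g 0)), by fun_prop, ?_⟩
  rintro _ ⟨t, rfl⟩
  simp only
  rw [key, Complex.exp_add, h, Complex.exp_log (h0' _)]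
  simp [h0']

lemma HasLog.congr {K : Set ℂ} {f g : ℂ → ℂ} (h : HasLog K f) (hfg : ∀ z ∈ K, f z = g z) : HasLog K g := by
  obtain ⟨h, hc, hh⟩ := h
  exact ⟨h, hc, fun z hz => (hh z hz).trans (hfg z hz)⟩

lemma HasLog.mono {K K' : Set ℂ} {f : ℂ → ℂ} (h : HasLog K f) (hK : K' ⊆ K) : HasLog K' f := by
  obtain ⟨h, hc, hh⟩ := h
  exact ⟨h, hc.mono hK, fun z hz => hh z (hK hz)⟩

lemma HasLog.inv {K : Set ℂ} {f : ℂ → ℂ} (h : HasLog K f) : HasLog K (fun z => (f z)⁻¹) := by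
  obtain ⟨h, hc, hh⟩ := h
  exact ⟨fun z => - h z, hc.neg, fun z hz => by simp only [Complex.exp_neg, hh z hz]⟩

/-- Same component of the complement. -/
def Same {X : Type*} [TopologicalSpace X] (K : Set X) (p q : X) : Prop :=
  q ∈ connectedComponentIn Kᶜ p

section same
variable {X : Type*} [TopologicalSpace X] {K : Set X} {p q r : X}

lemma Same.left (h : Same K p q) : p ∉ K := by
  by_contra hp
  rw [Same, connectedComponentIn_eq_empty (by simpa using hp)] at h
  exact h

lemma Same.right (h : Same K p q) : q ∉ K := connectedComponentIn_subset _ _ h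

lemma Same.refl (h : p ∉ K) : Same K p p := mem_connectedComponentIn h

lemma Same.eq (h : Same K p q) : connectedComponentIn Kᶜ p = connectedComponentIn Kᶜ q :=
  connectedComponentIn_eq h

lemma Same.symm (h : Same K p q) : Same K q p := by
  rw [Same, ← h.eq]; exact mem_connectedComponentIn h.left

lemma Same.trans (h : Same K p q) (h' : Same K q r) : Same K p r := by
  rw [Same, h.eq]; exact h'

lemma Same.of_conn {S : Set X} (hS : IsPreconnected S) (hd : Disjoint S K) (hp : p ∈ S) (hq : q ∈ S) :
    Same K p q :=
  hS.subset_connectedComponentIn hp (subset_compl_iff_disjoint_right.2 hd) hq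

lemma Same.mono {K' : Set X} (h : Same K p q) (hK : K' ⊆ K) : Same K' p q :=
  connectedComponentIn_mono _ (compl_subset_compl.2 hK) h
end same

lemma E1 {K : Set ℂ} (hK : IsClosed K) {p q : ℂ} (h : Same K p q) :
    HasLog K (fun z => (z - q) / (z - p)) := by
  have hU : IsOpen (connectedComponentIn Kᶜ p) := hK.isOpen_compl.connectedComponentIn
  have hUc : IsConnected (connectedComponentIn Kᶜ p) :=
    isConnected_connectedComponentIn_iff.2 h.left
  have hp := (hU.isConnected_iff_isPathConnected.1 hUc).joinedIn p
    (mem_connectedComponentIn h.left) q h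
  obtain ⟨γ, hγ⟩ := hp
  have hγ' : ∀ t, γ t ∉ K := fun t => connectedComponentIn_subset _ _ (hγ t)
  have hne : ∀ (t) (z : K), (z : ℂ) - γ t ≠ 0 := fun t z hz =>
    hγ' t (by rw [← sub_eq_zero.1 hz]; exact z.2)
  have hne' : ∀ (z : K), (z : ℂ) - p ≠ 0 := fun z => by simpa using hne 0 z
  obtain ⟨L, hL, hh⟩ := lift (fun x : unitInterval × K => ((x.2 : ℂ) - γ x.1) / (x.2 - p))
    (by
      refine Continuous.div (by fun_prop) (by fun_prop) (fun x => hne' _))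
    (fun x => div_ne_zero (hne _ _) (hne' _)) (fun x => by
      simp [hne'])
  obtain ⟨h', hh'⟩ := ContinuousMap.exists_restrict_eq hK ⟨L, hL⟩
  refine ⟨h', h'.continuous.continuousOn, fun z hz => ?_⟩
  have := DFunLike.congr_fun hh' ⟨z, hz⟩
  simp only [ContinuousMap.restrict_apply, ContinuousMap.coe_mk] at this
  rw [this, hh]
  simp

/-- Log of `(z-b)/(z-a)` on the complement of an arc. -/
lemma E1' {A : Set ℂ} {a b : ℂ} (hA : IsArc A a b) :
    HasLog Aᶜ (fun z => (z - b) / (z - a)) := by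
  obtain ⟨g, gc, gi, rfl, rfl, rfl⟩ := hA
  have hne : ∀ (t) (z : ↥(range g)ᶜ), (z : ℂ) - g t ≠ 0 := fun t z hz =>
    z.2 (by rw [sub_eq_zero.1 hz]; exact mem_range_self t)
  obtain ⟨L, hL, hh⟩ := lift (fun x : unitInterval × ↥(range g)ᶜ => ((x.2 : ℂ) - g x.1) / (x.2 - g 0))
    (by
      refine Continuous.div (by fun_prop) (by fun_prop) (fun x => hne _ _))
    (fun x => div_ne_zero (hne _ _) (hne _ _)) (fun x => by
      simp [hne])
  classical
  refine ⟨fun z => if hz : z ∈ (range g)ᶜ then L ⟨z, hz⟩ else 0, ?_, fun z hz => ?_⟩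
  · rw [continuousOn_iff_continuous_domRestrict]
    have : domRestrict (range g)ᶜ (fun z => if hz : z ∈ (range g)ᶜ then L ⟨z, hz⟩ else 0) = L := by
      funext z
      rw [domRestrict_apply, dif_pos z.2]
    rw [this]
    exact hL
  · simp only [dif_pos hz, hh]

end Pl


namespace Pl

section comp
variable {X : Type*} [TopologicalSpace X] [LocallyConnectedSpace X] {K : Set X} {p q : X}

lemma comp_open (hK : IsClosed K) : IsOpen (connectedComponentIn Kᶜ p) :=
  hK.isOpen_compl.connectedComponentIn

lemma frontier_comp (hK : IsClosed K) : frontier (connectedComponentIn Kᶜ p) ⊆ K := by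
  intro z hz
  by_contra hzK
  have ho : IsOpen (connectedComponentIn Kᶜ z) := comp_open hK
  obtain ⟨y, hy, hy'⟩ := mem_closure_iff.1 hz.1 _ ho (mem_connectedComponentIn hzK)
  have h1 : Same K z y := hy
  have h2 : Same K p y := hy'
  have h3 : Same K p z := h2.trans h1.symm
  rw [(comp_open hK).frontier_eq] at hz
  exact hz.2 h3
end comp

lemma core {K : Set ℂ} (hK : IsCompact K) {p : ℂ} (hp : p ∉ K)
    (hb : Bornology.IsBounded (connectedComponentIn Kᶜ p)) {g : ℂ → ℂ}
    (hg : ContinuousOn g (closure (connectedComponentIn Kᶜ p)))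
    (g0 : ∀ z ∈ closure (connectedComponentIn Kᶜ p), g z ≠ 0) {k : ℤ}
    (h : HasLog K (fun z => (z - p) ^ k * g z)) : k = 0 := by
  classical
  set U := connectedComponentIn Kᶜ p with hU
  have hpU : p ∈ U := mem_connectedComponentIn hp
  have hUo : IsOpen U := comp_open hK.isClosed
  obtain ⟨h, hc, hh⟩ := h
  obtain ⟨h', hh'⟩ := ContinuousMap.exists_restrict_eq hK.isClosed ⟨K.domRestrict h, continuousOn_iff_continuous_domRestrict.1 hc⟩
  have key : ∀ z ∈ K, h' z = h z := fun z hz => DFunLike.congr_fun hh' ⟨z, hz⟩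
  let w : ℂ → ℂ := U.piecewise (fun z => Complex.exp (h' z) / g z) (fun z => (z - p) ^ k)
  have hwc : Continuous w := by
    refine continuous_piecewise ?_ ?_ ?_
    · intro z hz
      have hzK := frontier_comp hK.isClosed hz
      rw [key z hzK, hh z hzK]
      simp only
      rw [mul_div_cancel_right₀ _ (g0 z hz.1)]
    · exact ContinuousOn.div (by fun_prop) hg g0
    · rw [hUo.isClosed_compl.closure_eq]
      refine ContinuousOn.zpow₀ (by fun_prop) _ ?_
      intro z hz
      left
      intro h
      rw [sub_eq_zero] at h
      exact hz (h ▸ hpU)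
  have hw0 : ∀ z, w z ≠ 0 := by
    intro z
    by_cases hz : z ∈ U
    · simp only [w, piecewise_eq_of_mem _ _ _ hz]
      exact div_ne_zero (Complex.exp_ne_zero _) (g0 z (subset_closure hz))
    · simp only [w, piecewise_eq_of_notMem _ _ _ hz]
      apply zpow_ne_zero
      intro h
      rw [sub_eq_zero] at h
      exact hz (h ▸ hpU)
  obtain ⟨L, hL, hLw⟩ := log_plane hwc hw0
  obtain ⟨R, hR0, hR⟩ : ∃ R > 0, U ⊆ Metric.ball p R := by
    obtain ⟨R, hR⟩ := hb.subset_ball p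
    exact ⟨max R 1, by positivity, hR.trans (Metric.ball_subset_ball (le_max_left _ _))⟩
  refine circle (H := fun t => L (p + Complex.exp (Real.log R + t * Complex.I)))
    (G := fun _ => k * Real.log R) (by fun_prop) (by fun_prop) ?_ ?_ rfl
  · intro t
    rw [hLw]
    have : p + Complex.exp (Real.log R + t * Complex.I) ∉ U := by
      intro hm
      have := hR hm
      rw [Metric.mem_ball, dist_eq_norm, add_sub_cancel_left, Complex.norm_exp] at this
      simp [Real.exp_log hR0] at this
    simp only [w, piecewise_eq_of_notMem _ _ _ this]
    rw [add_sub_cancel_left, ← Complex.exp_int_mul]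
    congr 1
    ring
  · congr 2
    rw [Complex.exp_eq_exp_iff_exists_int]
    exact ⟨-1, by push_cast; ring⟩

lemma ext_conn (R : ℝ) : IsPreconnected {z : ℂ | R < ‖z‖} := by
  have : {z : ℂ | R < ‖z‖} = (fun x : ℝ × ℝ => (x.1 : ℂ) * Complex.exp (x.2 * Complex.I)) '' (Ioi R ×ˢ univ) := by
    ext z
    simp only [mem_ofPred_eq, mem_image, mem_prod, mem_Ioi, mem_univ, and_true, Prod.exists]
    constructor
    · intro h
      exact ⟨‖z‖, z.arg, h, Complex.norm_mul_exp_arg_mul_I z⟩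
    · rintro ⟨r, t, hr, rfl⟩
      rw [norm_mul, Complex.norm_exp_ofReal_mul_I, mul_one, Complex.norm_real, Real.norm_eq_abs]
      exact lt_of_lt_of_le hr (le_abs_self r)
  rw [this]
  exact (isPreconnected_Ioi.prod isPreconnected_univ).image _ (by fun_prop)

lemma bounded_or {K : Set ℂ} (hK : IsCompact K) {p q : ℂ} (h : ¬ Same K p q) :
    Bornology.IsBounded (connectedComponentIn Kᶜ p) ∨ Bornology.IsBounded (connectedComponentIn Kᶜ q) := by
  obtain ⟨R, hR⟩ := hK.isBounded.subset_closedBall (0 : ℂ)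
  set R' := max R 0
  have hd : Disjoint {z : ℂ | R' < ‖z‖} K := by
    rw [disjoint_left]
    intro z hz hzK
    have := hR hzK
    rw [mem_closedBall_zero_iff] at this
    exact absurd (lt_of_le_of_lt (le_max_left R 0) hz) (not_lt.2 this)
  by_contra hcon
  push Not at hcon
  have aux : ∀ p, ¬ Bornology.IsBounded (connectedComponentIn Kᶜ p) → ∃ x, Same K p x ∧ R' < ‖x‖ := by
    intro p hp
    by_contra hx
    push Not at hx
    exact hp (Metric.isBounded_closedBall.subset (fun z hz => mem_closedBall_zero_iff.2 (hx z hz)))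
  obtain ⟨x, hx, hx'⟩ := aux p hcon.1
  obtain ⟨y, hy, hy'⟩ := aux q hcon.2
  exact h (hx.trans ((Same.of_conn (ext_conn R') hd hx' hy').trans hy.symm))

lemma closure_ne {K : Set ℂ} (hK : IsClosed K) {p q : ℂ} (hq : q ∉ K) (h : ¬ Same K p q) :
    ∀ z ∈ closure (connectedComponentIn Kᶜ p), z - q ≠ 0 := by
  intro z hz h0
  rw [sub_eq_zero] at h0
  subst h0
  by_cases hm : z ∈ connectedComponentIn Kᶜ p
  · exact h hm
  · refine hq (frontier_comp (p := p) hK ?_)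
    rw [(comp_open hK).frontier_eq]
    exact ⟨hz, hm⟩

lemma E2 {K : Set ℂ} (hK : IsCompact K) {p q : ℂ} (hp : p ∉ K) (hq : q ∉ K)
    (h : HasLog K (fun z => (z - q) / (z - p))) : Same K p q := by
  by_contra hs
  rcases bounded_or hK hs with hb | hb
  · have hne := closure_ne hK.isClosed hq hs
    have := core hK hp hb (g := fun z => (z - q)) (k := -1) (by fun_prop) hne
      (h.congr (fun z hz => by rw [zpow_neg_one, div_eq_inv_mul]))
    omega
  · have hne := closure_ne hK.isClosed hp (fun h => hs h.symm)
    have := core hK hq hb (g := fun z => (z - p)⁻¹) (k := 1)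
      (ContinuousOn.inv₀ (by fun_prop) hne) (fun z hz => inv_ne_zero (hne z hz))
      (h.congr (fun z hz => by rw [zpow_one, div_eq_mul_inv]))
    omega

/-- three points version -/
lemma E3 {K : Set ℂ} (hK : IsCompact K) {p q r : ℂ} (hp : p ∉ K) (hq : q ∉ K) (hr : r ∉ K)
    (hpq : ¬ Same K p q) (hpr : ¬ Same K p r) (hqr : ¬ Same K q r) {a b : ℤ} (ha : a ≠ 0) (hb : b ≠ 0)
    (h : HasLog K (fun z => ((z - q) / (z - p)) ^ a * ((z - r) / (z - p)) ^ b)) : False := by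
  have key : ∀ {q r : ℂ} (hq : q ∉ K) (hr : r ∉ K)
    (hpq : ¬ Same K p q) (hpr : ¬ Same K p r) (hqr : ¬ Same K q r) {a b : ℤ} (ha : a ≠ 0)
    (h : HasLog K (fun z => ((z - q) / (z - p)) ^ a * ((z - r) / (z - p)) ^ b))
    (hb : Bornology.IsBounded (connectedComponentIn Kᶜ q)), False := by
    intro q r hq hr hpq hpr hqr a b ha h hb
    have hne := closure_ne hK.isClosed hp (fun h => hpq h.symm)
    have hne' := closure_ne hK.isClosed hr hqr
    apply ha
    refine core hK hq hb (g := fun z => ((z - p)⁻¹) ^ a * ((z - r) / (z - p)) ^ b) ?_ ?_ (h.congr ?_)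
    · refine ContinuousOn.mul (ContinuousOn.zpow₀ (ContinuousOn.inv₀ (by fun_prop) hne) _ ?_)
        (ContinuousOn.zpow₀ (ContinuousOn.div (by fun_prop) (by fun_prop) hne) _ ?_)
      · exact fun z hz => Or.inl (inv_ne_zero (hne z hz))
      · exact fun z hz => Or.inl (div_ne_zero (hne' z hz) (hne z hz))
    · exact fun z hz => mul_ne_zero (zpow_ne_zero _ (inv_ne_zero (hne z hz)))
        (zpow_ne_zero _ (div_ne_zero (hne' z hz) (hne z hz)))
    · intro z hz
      rw [div_eq_mul_inv, mul_zpow, mul_assoc]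
  rcases bounded_or hK hqr with hB | hB
  · exact key hq hr hpq hpr hqr ha h hB
  · exact key hr hq hpr hpq (fun h => hqr h.symm) hb (h.congr (fun z hz => mul_comm _ _)) hB

lemma glue {A B : Set ℂ} {f : ℂ → ℂ} {a b : ℂ → ℂ} (ha : ContinuousOn a A) (hb : ContinuousOn b B)
    (ea : ∀ z ∈ A, Complex.exp (a z) = f z) (eb : ∀ z ∈ B, Complex.exp (b z) = f z)
    (hab : ∀ z ∈ A ∩ B, a z = b z) (hu : (IsClosed A ∧ IsClosed B) ∨ (IsOpen A ∧ IsOpen B)) :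
    HasLog (A ∪ B) f := by
  classical
  have hA : EqOn (A.piecewise a b) a A := fun z hz => piecewise_eq_of_mem _ _ _ hz
  have hB : EqOn (A.piecewise a b) b B := fun z hz => by
    by_cases h : z ∈ A
    · rw [piecewise_eq_of_mem _ _ _ h, hab z ⟨h, hz⟩]
    · rw [piecewise_eq_of_notMem _ _ _ h]
  refine ⟨A.piecewise a b, ?_, ?_⟩
  · have h1 := ha.congr hA
    have h2 := hb.congr hB
    rcases hu with ⟨x, y⟩ | ⟨x, y⟩
    · exact h1.union_of_isClosed h2 x y
    · exact h1.union_of_isOpen h2 x y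
  · rintro z (hz | hz)
    · rw [hA hz, ea z hz]
    · rw [hB hz, eb z hz]

lemma glue_conn {A B : Set ℂ} {f : ℂ → ℂ} (hA : HasLog A f) (hB : HasLog B f)
    (hc : IsPreconnected (A ∩ B)) (hu : (IsClosed A ∧ IsClosed B) ∨ (IsOpen A ∧ IsOpen B)) :
    HasLog (A ∪ B) f := by
  obtain ⟨a, ca, ea⟩ := hA
  obtain ⟨b, cb, eb⟩ := hB
  rcases (A ∩ B).eq_empty_or_nonempty with he | ⟨x, hx⟩
  · exact glue ca cb ea eb (by simp [he]) hu
  have hconst : ∀ z ∈ A ∩ B, a z - b z = a x - b x := fun z hz =>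
    exp_const hc (f := fun z => a z - b z)
      ((ca.mono inter_subset_left).sub (cb.mono inter_subset_right))
      (fun y hy => by
        rw [Complex.exp_sub, ea y hy.1, eb y hy.2, div_self]
        rw [← ea y hy.1]; exact Complex.exp_ne_zero _) hz hx
  refine glue ca (b := fun z => b z + (a x - b x)) (cb.add continuousOn_const) ea ?_ ?_ hu
  · intro z hz
    rw [Complex.exp_add, Complex.exp_sub, ea x hx.1, eb x hx.2, eb z hz, div_self, mul_one]
    rw [← ea x hx.1]; exact Complex.exp_ne_zero _
  · intro z hz
    have := hconst z hz
    linear_combination this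

lemma janC {A B : Set ℂ} (hA : IsCompact A) (hB : IsCompact B) (hc : IsPreconnected (A ∩ B))
    {p q : ℂ} (ha : Same A p q) (hb : Same B p q) : Same (A ∪ B) p q := by
  refine E2 (hA.union hB) ?_ ?_ (glue_conn (E1 hA.isClosed ha) (E1 hB.isClosed hb) hc (Or.inl ⟨hA.isClosed, hB.isClosed⟩))
  · exact fun h => h.elim ha.left hb.left
  · exact fun h => h.elim ha.right hb.right

section arc
variable {X : Type*} [TopologicalSpace X] {S : Set X} {a b : X}

lemma IsArc.compact (h : IsArc S a b) : IsCompact S := by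
  obtain ⟨f, hf, -, rfl, -, -⟩ := h
  exact isCompact_range hf

lemma IsArc.left_mem (h : IsArc S a b) : a ∈ S := by
  obtain ⟨f, hf, -, rfl, rfl, -⟩ := h
  exact mem_range_self _

lemma IsArc.right_mem (h : IsArc S a b) : b ∈ S := by
  obtain ⟨f, hf, -, rfl, -, rfl⟩ := h
  exact mem_range_self _

lemma IsArc.ne (h : IsArc S a b) : a ≠ b := by
  obtain ⟨f, hf, hi, rfl, rfl, rfl⟩ := h
  exact fun h => zero_ne_one (hi h)
end arc

lemma arc_nonsepC {A : Set ℂ} {a b : ℂ} (hA : IsArc A a b) {p q : ℂ} (hp : p ∉ A) (hq : q ∉ A) : Same A p q := by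
  refine E2 hA.compact hp hq (arc_log hA ?_ ?_)
  · refine ContinuousOn.div (by fun_prop) (by fun_prop) ?_
    exact fun z hz h => hp (sub_eq_zero.1 h ▸ hz)
  · exact fun z hz => div_ne_zero (fun h => hq (sub_eq_zero.1 h ▸ hz)) (fun h => hp (sub_eq_zero.1 h ▸ hz))

lemma jordanC {A B : Set ℂ} {a b : ℂ} (hA : IsArc A a b) (hB : IsArc B a b) (hAB : A ∩ B ⊆ {a, b}) :
    ∃ p q, p ∉ A ∪ B ∧ q ∉ A ∪ B ∧ ¬ Same (A ∪ B) p q := by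
  by_contra hcon
  push Not at hcon
  have hc : IsPreconnected (Aᶜ ∩ Bᶜ) := by
    rw [← compl_union]
    rcases ((A ∪ B)ᶜ).eq_empty_or_nonempty with he | ⟨x, hx⟩
    · rw [he]; exact isPreconnected_empty
    have : connectedComponentIn (A ∪ B)ᶜ x = (A ∪ B)ᶜ :=
      Subset.antisymm (connectedComponentIn_subset _ _) (fun y hy => hcon x y hx hy)
    rw [← this]
    exact isPreconnected_connectedComponentIn
  obtain ⟨L, cL, eL⟩ := glue_conn (E1' hA) (E1' hB) hc
    (Or.inr ⟨hA.compact.isClosed.isOpen_compl, hB.compact.isClosed.isOpen_compl⟩)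
  have hm : ∀ z, z ≠ a → z ≠ b → z ∈ Aᶜ ∪ Bᶜ := by
    intro z h1 h2
    rw [← compl_inter]
    intro h
    rcases hAB h with h | h
    · exact h1 h
    · exact h2 h
  have hab : a - b ≠ 0 := sub_ne_zero.2 hA.ne
  -- the circle `a + (a-b)/2 * e^{it}`
  let c : ℝ → ℂ := fun t => a + (a - b) * (Complex.exp (t * Complex.I) / 2)
  have hca : ∀ t, c t - a ≠ 0 := fun t => by
    simp only [c, add_sub_cancel_left]
    exact mul_ne_zero hab (div_ne_zero (Complex.exp_ne_zero _) two_ne_zero)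
  have hsl : ∀ t : ℝ, 1 + Complex.exp (t * Complex.I) / 2 ∈ Complex.slitPlane := fun t => by
    apply Complex.mem_slitPlane_of_norm_lt_one
    rw [norm_div, Complex.norm_exp_ofReal_mul_I]
    norm_num
  have hcb' : ∀ t, c t - b = (a - b) * (1 + Complex.exp (t * Complex.I) / 2) := fun t => by
    simp only [c]; ring
  have hcb : ∀ t, c t - b ≠ 0 := fun t => by
    rw [hcb']
    exact mul_ne_zero hab (Complex.slitPlane_ne_zero (hsl t))
  have hcc : Continuous c := by fun_prop
  have per : Complex.exp (((2 * Real.pi : ℝ) : ℂ) * Complex.I) = Complex.exp (((0:ℝ) : ℂ) * Complex.I) := by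
    rw [Complex.exp_eq_exp_iff_exists_int]
    exact ⟨1, by push_cast; ring⟩
  have := circle (H := fun t => L (c t))
    (G := fun t => Complex.log (1 + Complex.exp (t * Complex.I) / 2) + Complex.log 2) (k := -1) ?_ ?_ ?_ ?_ ?_
  · omega
  · exact cL.comp_continuous hcc (fun t => hm _ (sub_ne_zero.1 (hca t)) (sub_ne_zero.1 (hcb t)))
  · refine Continuous.add (Continuous.clog (by fun_prop) hsl) continuous_const
  · intro t
    rw [eL _ (hm _ (sub_ne_zero.1 (hca t)) (sub_ne_zero.1 (hcb t))), Complex.exp_add, Complex.exp_add,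
      Complex.exp_log (Complex.slitPlane_ne_zero (hsl t)), Complex.exp_log two_ne_zero]
    beta_reduce
    rw [hcb']
    have : c t - a = (a - b) * (Complex.exp (t * Complex.I) / 2) := by simp only [c]; ring
    rw [this, mul_div_mul_left _ _ hab]
    push_cast
    rw [neg_one_mul, Complex.exp_neg]
    have := Complex.exp_ne_zero (t * Complex.I)
    field_simp
  · simp only [c, per]
  · simp only [per]

lemma zlog {K : Set ℂ} {f g : ℂ → ℂ} (m n : ℤ) {hf hg : ℂ → ℂ} 
    (ef : ∀ z ∈ K, Complex.exp (hf z) = f z) (eg : ∀ z ∈ K, Complex.exp (hg z) = g z) :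
    ∀ z ∈ K, Complex.exp (m * hf z + n * hg z) = f z ^ m * g z ^ n := by
  intro z hz
  rw [Complex.exp_add, Complex.exp_int_mul, Complex.exp_int_mul, ef z hz, eg z hz]

lemma maxTwoC {K A : Set ℂ} {a b : ℂ} (hK : IsCompact K) (hA : IsArc A a b) (hKA : K ∩ A ⊆ {a, b})
    {p q r : ℂ} (hpq : Same K p q) (hpr : Same K p r) (hp : p ∉ A) (hq : q ∉ A) (hr : r ∉ A) :
    Same (K ∪ A) p q ∨ Same (K ∪ A) p r ∨ Same (K ∪ A) q r := by
  have hKA' : IsCompact (K ∪ A) := hK.union hA.compact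
  have hp' : p ∉ K ∪ A := fun h => h.elim hpq.left hp
  have hq' : q ∉ K ∪ A := fun h => h.elim hpq.right hq
  have hr' : r ∉ K ∪ A := fun h => h.elim hpr.right hr
  by_cases hpre : IsPreconnected (K ∩ A)
  · exact Or.inl (janC hK hA.compact hpre hpq (arc_nonsepC hA hp hq))
  have haK : a ∈ K ∧ b ∈ K := by
    by_contra hcon
    apply hpre
    apply Set.Subsingleton.isPreconnected
    intro x hx y hy
    have h1 := hKA hx
    have h2 := hKA hy
    simp only [mem_insert_iff, mem_singleton_iff] at h1 h2
    rcases h1 with rfl | rfl <;> rcases h2 with rfl | rfl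
    · rfl
    · exact absurd ⟨hx.1, hy.1⟩ hcon
    · exact absurd ⟨hy.1, hx.1⟩ hcon
    · rfl
  have haA := hA.left_mem
  have hbA := hA.right_mem
  obtain ⟨kq, ckq, ekq⟩ := E1 hK.isClosed hpq
  obtain ⟨kr, ckr, ekr⟩ := E1 hK.isClosed hpr
  obtain ⟨aq, caq, eaq⟩ := E1 hA.compact.isClosed (arc_nonsepC hA hp hq)
  obtain ⟨ar, car, ear⟩ := E1 hA.compact.isClosed (arc_nonsepC hA hp hr)
  have int : ∀ {k l : ℂ → ℂ} {f : ℂ → ℂ} (_ : ∀ z ∈ K, Complex.exp (k z) = f z)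
      (_ : ∀ z ∈ A, Complex.exp (l z) = f z), ∀ z ∈ K ∩ A, ∃ m : ℤ, k z = l z + m * (2 * Real.pi * Complex.I) := by
    intro k l f e1 e2 z hz
    exact Complex.exp_eq_exp_iff_exists_int.1 ((e1 z hz.1).trans (e2 z hz.2).symm)
  obtain ⟨qa, hqa⟩ := int ekq eaq a ⟨haK.1, haA⟩
  obtain ⟨qb, hqb⟩ := int ekq eaq b ⟨haK.2, hbA⟩
  obtain ⟨ra, hra⟩ := int ekr ear a ⟨haK.1, haA⟩
  obtain ⟨rb, hrb⟩ := int ekr ear b ⟨haK.2, hbA⟩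
  -- general gluing
  have gl : ∀ m n : ℤ, m * (qb - qa) + n * (rb - ra) = 0 →
      HasLog (K ∪ A) (fun z => ((z - q) / (z - p)) ^ m * ((z - r) / (z - p)) ^ n) := by
    intro m n hmn
    have hmn' : (m : ℂ) * (qb - qa) + n * (rb - ra) = 0 := by exact_mod_cast hmn
    refine glue (a := fun z => m * kq z + n * kr z)
      (b := fun z => m * aq z + n * ar z + (m * qa + n * ra : ℤ) * (2 * Real.pi * Complex.I))
      ?_ ?_ (zlog m n ekq ekr) ?_ ?_ (Or.inl ⟨hK.isClosed, hA.compact.isClosed⟩)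
    · exact (continuousOn_const.mul ckq).add (continuousOn_const.mul ckr)
    · exact ((continuousOn_const.mul caq).add (continuousOn_const.mul car)).add continuousOn_const
    · intro z hz
      rw [Complex.exp_add, Complex.exp_int_mul_two_pi_mul_I, mul_one]
      exact zlog m n eaq ear z hz
    · intro z hz
      have h1 := hKA hz
      simp only [mem_insert_iff, mem_singleton_iff] at h1
      rcases h1 with rfl | rfl
      · simp only [hqa, hra]; push_cast; ring
      · simp only [hqb, hrb]; push_cast
        linear_combination (2 * Real.pi * Complex.I) * hmn'
  by_contra hcon
  push Not at hcon
  obtain ⟨n1, n2, n3⟩ := hcon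
  have dq : qb - qa ≠ 0 := by
    intro h0
    exact n1 (E2 hKA' hp' hq' ((gl 1 0 (by simp [h0])).congr (fun z _ => by simp)))
  have dr : rb - ra ≠ 0 := by
    intro h0
    exact n2 (E2 hKA' hp' hr' ((gl 0 1 (by simp [h0])).congr (fun z _ => by simp)))
  exact E3 hKA' hp' hq' hr' n1 n2 n3 dr (neg_ne_zero.2 dq) (gl _ _ (by ring))

end Pl


namespace Pl

lemma Same.map {X Y : Type*} [TopologicalSpace X] [TopologicalSpace Y] (φ : X ≃ₜ Y) {K : Set X} {p q : X}
    (h : Same K p q) : Same (φ '' K) (φ p) (φ q) := by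
  have := φ.image_connectedComponentIn (s := Kᶜ) (x := p) h.left
  rw [Same, ← image_compl_eq φ.bijective, ← this]
  exact mem_image_of_mem _ h

lemma Same.map_iff {X Y : Type*} [TopologicalSpace X] [TopologicalSpace Y] (φ : X ≃ₜ Y) {K : Set X} {p q : X} :
    Same (φ '' K) (φ p) (φ q) ↔ Same K p q := by
  refine ⟨fun h => ?_, Same.map φ⟩
  have := h.map φ.symm
  simpa [image_image] using this

lemma IsArc.map {X Y : Type*} [TopologicalSpace X] [TopologicalSpace Y] (φ : X ≃ₜ Y) {S : Set X} {a b : X}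
    (h : IsArc S a b) : IsArc (φ '' S) (φ a) (φ b) := by
  obtain ⟨f, hf, hi, rfl, rfl, rfl⟩ := h
  exact ⟨φ ∘ f, φ.continuous.comp hf, φ.injective.comp hi, range_comp _ _, rfl, rfl⟩

noncomputable def toC : ℝ × ℝ ≃ₜ ℂ := Complex.equivRealProdCLM.symm.toHomeomorph

lemma jan {A B : Set (ℝ × ℝ)} (hA : IsCompact A) (hB : IsCompact B) (hc : IsPreconnected (A ∩ B))
    {p q : ℝ × ℝ} (ha : Same A p q) (hb : Same B p q) : Same (A ∪ B) p q := by
  rw [← Same.map_iff toC] at *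
  rw [image_union]
  refine janC (hA.image toC.continuous) (hB.image toC.continuous) ?_ ha hb
  rw [← image_inter toC.injective]
  exact hc.image _ toC.continuous.continuousOn

lemma arc_nonsep {A : Set (ℝ × ℝ)} {a b : ℝ × ℝ} (hA : IsArc A a b) {p q : ℝ × ℝ} (hp : p ∉ A) (hq : q ∉ A) :
    Same A p q := by
  rw [← Same.map_iff toC]
  exact arc_nonsepC (hA.map toC) (by simpa using hp) (by simpa using hq)

lemma jordan {A B : Set (ℝ × ℝ)} {a b : ℝ × ℝ} (hA : IsArc A a b) (hB : IsArc B a b) (hAB : A ∩ B ⊆ {a, b}) :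
    ∃ p q, p ∉ A ∪ B ∧ q ∉ A ∪ B ∧ ¬ Same (A ∪ B) p q := by
  obtain ⟨p, q, hp, hq, h⟩ := jordanC (hA.map toC) (hB.map toC) (by
    rw [← image_inter toC.injective, ← image_pair]
    exact image_mono hAB)
  obtain ⟨p, rfl⟩ := toC.surjective p
  obtain ⟨q, rfl⟩ := toC.surjective q
  rw [← image_union] at hp hq h
  rw [Same.map_iff] at h
  exact ⟨p, q, by simpa using hp, by simpa using hq, h⟩

lemma maxTwo {K A : Set (ℝ × ℝ)} {a b : ℝ × ℝ} (hK : IsCompact K) (hA : IsArc A a b) (hKA : K ∩ A ⊆ {a, b})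
    {p q r : ℝ × ℝ} (hpq : Same K p q) (hpr : Same K p r) (hp : p ∉ A) (hq : q ∉ A) (hr : r ∉ A) :
    Same (K ∪ A) p q ∨ Same (K ∪ A) p r ∨ Same (K ∪ A) q r := by
  have := maxTwoC (hK.image toC.continuous) (hA.map toC) (by
    rw [← image_inter toC.injective, ← image_pair]
    exact image_mono hKA) (hpq.map toC) (hpr.map toC) (by simpa using hp) (by simpa using hq) (by simpa using hr)
  rw [← image_union] at this
  simpa only [Same.map_iff] using this

section arcs
variable {X : Type*} [TopologicalSpace X] {S T : Set X} {a b c : X}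

lemma IsArc.symm (h : IsArc S a b) : IsArc S b a := by
  obtain ⟨f, hf, hi, rfl, rfl, rfl⟩ := h
  refine ⟨f ∘ unitInterval.symm, by fun_prop, hi.comp unitInterval.symm_bijective.injective, ?_, by simp, by simp⟩
  rw [range_comp, unitInterval.symm_bijective.surjective.range_eq, image_univ]

/-- image of a segment -/
lemma isArc_image {f : unitInterval → X} (hf : Continuous f) (hi : Function.Injective f) {s t : unitInterval}
    (hst : s < t) : IsArc (f '' Icc s t) (f s) (f t) := by
  have hst' : (s : ℝ) < t := hst
  have hm : ∀ r : unitInterval, (s : ℝ) + r * (t - s) ∈ unitInterval := fun r =>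
    ⟨by have := s.2.1; have := r.2.1; nlinarith, by have := t.2.2; have := r.2.2; nlinarith⟩
  let g : unitInterval → unitInterval := fun r => ⟨s + r * (t - s), hm r⟩
  refine ⟨f ∘ g, by fun_prop, hi.comp ?_, ?_, ?_, ?_⟩
  · intro x y hxy
    have : (s : ℝ) + x * (t - s) = s + y * (t - s) := congrArg Subtype.val hxy
    have h2 : (x : ℝ) * (t - s) = y * (t - s) := by linarith
    exact Subtype.ext (mul_right_cancel₀ (by linarith) h2)
  · rw [range_comp]
    congr 1
    ext x
    simp only [mem_range, mem_Icc]
    constructor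
    · rintro ⟨r, rfl⟩
      have h0 := r.2.1
      have h1 := r.2.2
      constructor
      · change (s : ℝ) ≤ s + r * (t - s); nlinarith
      · change (s : ℝ) + r * (t - s) ≤ t; nlinarith
    · rintro ⟨h1, h2⟩
      have h1' : (s : ℝ) ≤ x := h1
      have h2' : (x : ℝ) ≤ t := h2
      refine ⟨⟨(x - s) / (t - s), div_nonneg (by linarith) (by linarith),
        (div_le_one (by linarith)).2 (by linarith)⟩, Subtype.ext ?_⟩
      change (s : ℝ) + (x - s) / (t - s) * (t - s) = x
      rw [div_mul_cancel₀ _ (by linarith : (t : ℝ) - s ≠ 0)]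
      ring
  · simp [g]
  · simp [g]

lemma IsArc.diff_conn (h : IsArc S a b) (hT : S ∩ T ⊆ {a, b}) : IsPreconnected (S \ T) := by
  obtain ⟨f, hf, hi, rfl, rfl, rfl⟩ := h
  have : range f \ T = f '' (f ⁻¹' Tᶜ) := by
    rw [image_preimage_eq_range_inter]; rfl
  rw [this]
  refine IsPreconnected.image ?_ _ hf.continuousOn
  have key : ∀ z : unitInterval, 0 < z → z < 1 → z ∈ f ⁻¹' Tᶜ := by
    intro z h0 h1 hz
    rcases hT ⟨mem_range_self z, hz⟩ with h | h
    · exact h0.ne' (hi h)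
    · exact h1.ne (hi h)
  have : OrdConnected (f ⁻¹' Tᶜ) := by
    refine ⟨fun x hx y hy z hz => ?_⟩
    rcases hz.1.eq_or_lt with rfl | h1
    · exact hx
    rcases hz.2.eq_or_lt with rfl | h2
    · exact hy
    exact key z (lt_of_le_of_lt x.2.1 h1) (lt_of_lt_of_le h2 y.2.2)
  exact this.isPreconnected

lemma IsArc.conn (h : IsArc S a b) : IsPreconnected S := by
  simpa using h.diff_conn (T := ∅) (by simp)

lemma IsArc.subset_closure (h : IsArc S a b) : S ⊆ closure (S \ {a, b}) := by
  obtain ⟨f, hf, hi, rfl, rfl, rfl⟩ := h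
  rintro _ ⟨t, rfl⟩
  have h1 : t ∈ closure (Ioo (0 : unitInterval) 1) := by
    rw [closure_Ioo zero_ne_one]; exact ⟨t.2.1, t.2.2⟩
  refine closure_mono ?_ (image_closure_subset_closure_image hf (mem_image_of_mem f h1))
  rintro _ ⟨s, hs, rfl⟩
  refine ⟨mem_range_self s, ?_⟩
  rintro (h | h)
  · exact hs.1.ne' (hi h)
  · exact hs.2.ne (hi h)

lemma IsArc.split (h : IsArc S a b) {x : X} (hx : x ∈ S \ {a, b}) {V : Set X} (hV : IsOpen V) (hxV : x ∈ V) :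
    ∃ A B c d, IsArc A a c ∧ IsArc B d b ∧ Disjoint A B ∧ A ⊆ S ∧ B ⊆ S ∧ b ∉ A ∧ a ∉ B ∧ x ∉ A ∧ x ∉ B ∧
      S ⊆ A ∪ B ∪ V := by
  obtain ⟨f, hf, hi, rfl, rfl, rfl⟩ := h
  obtain ⟨⟨t, rfl⟩, ht⟩ := hx
  have ht0 : 0 < t := lt_of_le_of_ne t.2.1 (fun h => ht (Or.inl (by rw [← h])))
  have ht1 : t < 1 := lt_of_le_of_ne t.2.2 (fun h => ht (Or.inr (by rw [h]; rfl)))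
  have hn : f ⁻¹' V ∈ 𝓝 t := (hV.preimage hf).mem_nhds hxV
  obtain ⟨l, u, ⟨hl, hu⟩, hlu⟩ := (mem_nhds_iff_exists_Ioo_subset' ⟨0, ht0⟩ ⟨1, ht1⟩).1 hn
  obtain ⟨s, hs1, hs2⟩ := exists_between (max_lt hl ht0)
  obtain ⟨r, hr1, hr2⟩ := exists_between (lt_min hu ht1)
  rw [max_lt_iff] at hs1
  rw [lt_min_iff] at hr2
  refine ⟨f '' Icc 0 s, f '' Icc r 1, f s, f r, isArc_image hf hi hs1.2, isArc_image hf hi hr2.2,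
    ?_, image_subset_range _ _, image_subset_range _ _, ?_, ?_, ?_, ?_, ?_⟩
  · rw [disjoint_image_iff hi, disjoint_left]
    intro z hz hz'
    exact absurd (hz.2.trans_lt (hs2.trans (hr1.trans_le hz'.1))) (lt_irrefl _)
  · rw [hi.mem_set_image]; exact fun h => absurd (h.2.trans_lt (hs2.trans ht1)) (lt_irrefl _)
  · rw [hi.mem_set_image]; exact fun h => absurd ((ht0.trans hr1).trans_le h.1) (lt_irrefl _)
  · rw [hi.mem_set_image]; exact fun h => absurd (h.2.trans_lt hs2) (lt_irrefl _)
  · rw [hi.mem_set_image]; exact fun h => absurd (hr1.trans_le h.1) (lt_irrefl _)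
  · rintro _ ⟨z, rfl⟩
    rcases le_or_gt z s with h1 | h1
    · exact Or.inl (Or.inl ⟨z, ⟨z.2.1, h1⟩, rfl⟩)
    rcases le_or_gt r z with h2 | h2
    · exact Or.inl (Or.inr ⟨z, ⟨h2, z.2.2⟩, rfl⟩)
    · exact Or.inr (hlu ⟨hs1.1.trans h1, h2.trans hr2.1⟩)

lemma IsArc.concat (hS : IsArc S a b) (hT : IsArc T b c) (h : S ∩ T ⊆ {b}) : IsArc (S ∪ T) a c := by
  obtain ⟨f, hf, hfi, rfl, rfl, rfl⟩ := hS
  obtain ⟨g, hg, hgi, rfl, hg0, rfl⟩ := hT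
  let p : Path (f 0) (f 1) := ⟨⟨f, hf⟩, rfl, rfl⟩
  let q : Path (f 1) (g 1) := ⟨⟨g, hg⟩, hg0, rfl⟩
  refine ⟨p.trans q, (p.trans q).continuous, ?_, ?_, by simp, by simp⟩
  · have aux : ∀ x y : unitInterval, (x : ℝ) ≤ 1 / 2 → (p.trans q) x = (p.trans q) y → x = y := by
      intro x y hx hxy
      rw [Path.trans_apply, Path.trans_apply, dif_pos hx] at hxy
      split_ifs at hxy with hy
      · have := congrArg Subtype.val (hfi hxy)
        simp only at this
        exact Subtype.ext (by linarith)
      · exfalso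
        have h1 : g ⟨2 * (y:ℝ) - 1, (unitInterval.two_mul_sub_one_mem_iff).2 ⟨(not_le.1 hy).le, y.2.2⟩⟩ = f 1 := by
          have : q ⟨2 * (y:ℝ) - 1, (unitInterval.two_mul_sub_one_mem_iff).2 ⟨(not_le.1 hy).le, y.2.2⟩⟩ ∈ ({f 1} : Set X) :=
            h ⟨hxy ▸ mem_range_self (f := f) _, mem_range_self (f := g) _⟩
          exact this
        rw [← hg0] at h1
        have := congrArg Subtype.val (hgi h1)
        simp only [Set.Icc.coe_zero] at this
        exact hy (by linarith)
    intro x y hxy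
    rcases le_or_gt (x : ℝ) (1/2) with hx | hx
    · exact aux x y hx hxy
    rcases le_or_gt (y : ℝ) (1/2) with hy | hy
    · exact (aux y x hy hxy.symm).symm
    rw [Path.trans_apply, Path.trans_apply, dif_neg (not_le.2 hx), dif_neg (not_le.2 hy)] at hxy
    have := congrArg Subtype.val (hgi hxy)
    simp only at this
    exact Subtype.ext (by linarith)
  · rw [Path.trans_range]; rfl

end arcs

section derived

lemma touchPt {X : Type*} [TopologicalSpace X] {K K' : Set X} {p x : X} (hp : p ∉ K) (hK : K' ⊆ K)
    (hx : x ∈ closure (connectedComponentIn Kᶜ p)) (hxK : x ∉ K') : Same K' p x := by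
  refine Same.of_conn (S := insert x (connectedComponentIn Kᶜ p)) ?_ ?_ (Or.inr (mem_connectedComponentIn hp)) (Or.inl rfl)
  · exact (isPreconnected_connectedComponentIn).subset_closure (subset_insert _ _)
      (insert_subset hx subset_closure)
  · rw [disjoint_left]
    rintro y (rfl | hy)
    · exact hxK
    · exact fun h => connectedComponentIn_subset _ _ hy (hK h)

lemma stay {X : Type*} [TopologicalSpace X] [LocallyConnectedSpace X] {K K' : Set X} (hK : IsClosed K) {p z : X} (hp : p ∉ K)
    (hf : frontier (connectedComponentIn Kᶜ p) ⊆ K') (h : Same K' p z) : Same K p z := by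
  have hc : IsPreconnected (connectedComponentIn K'ᶜ p) := isPreconnected_connectedComponentIn
  have ho : IsOpen (connectedComponentIn Kᶜ p) := comp_open hK
  refine hc.subset_left_of_subset_union ho (isClosed_closure (s := connectedComponentIn Kᶜ p)).isOpen_compl ?_ ?_ ?_ h
  · exact disjoint_compl_right.mono_left subset_closure |>.mono_right (subset_refl _)
  · intro y hy
    by_cases h1 : y ∈ closure (connectedComponentIn Kᶜ p)
    · left
      by_contra h2
      refine connectedComponentIn_subset _ _ hy (hf ?_)
      rw [ho.frontier_eq]
      exact ⟨h1, h2⟩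
    · exact Or.inr h1
  · exact ⟨p, mem_connectedComponentIn h.left, mem_connectedComponentIn hp⟩

variable {K S : Set (ℝ × ℝ)} {a b : ℝ × ℝ}

lemma notMem_closure_of {K : Set (ℝ × ℝ)} {p x : ℝ × ℝ} (hK : IsClosed K) (hx : x ∈ K) 
    (h : x ∉ frontier (connectedComponentIn Kᶜ p)) : x ∉ closure (connectedComponentIn Kᶜ p) := by
  intro hc
  apply h
  rw [(comp_open hK).frontier_eq]
  exact ⟨hc, fun h => connectedComponentIn_subset _ _ h hx⟩

lemma pull (hK : IsCompact K) (hS : IsArc S a b) (hKS : K ∩ S ⊆ {a, b}) {x p z : ℝ × ℝ} (hx : x ∈ S \ {a, b})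
    (hp : p ∉ K ∪ S) (hxp : x ∉ frontier (connectedComponentIn (K ∪ S)ᶜ p)) (h : Same K p z)
    (hz : z ∉ S ∨ z = x) : Same (K ∪ S) p z := by
  have hcl : IsClosed (K ∪ S) := (hK.union hS.compact).isClosed
  have hxc := notMem_closure_of hcl (Or.inr hx.1) hxp
  obtain ⟨A, B, c, d, hA, hB, hd, hAS, hBS, hbA, haB, hxA, hxB, hcov⟩ :=
    hS.split hx isClosed_closure.isOpen_compl hxc
  have hpA : p ∉ A := fun h => hp (Or.inr (hAS h))
  have hpB : p ∉ B := fun h => hp (Or.inr (hBS h))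
  have hzA : z ∉ A := hz.elim (fun h h' => h (hAS h')) (fun h => h ▸ hxA)
  have hzB : z ∉ B := hz.elim (fun h h' => h (hBS h')) (fun h => h ▸ hxB)
  have h1 : Same (K ∪ A) p z := by
    refine jan hK hA.compact (Set.Subsingleton.isPreconnected ?_) h (arc_nonsep hA hpA hzA)
    have : ∀ y ∈ K ∩ A, y = a := fun y hy => (hKS ⟨hy.1, hAS hy.2⟩).elim id (fun h => absurd hy.2 (by rw [h]; exact hbA))
    exact fun y hy w hw => (this y hy).trans (this w hw).symm
  have h2 : Same ((K ∪ A) ∪ B) p z := by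
    refine jan (hK.union hA.compact) hB.compact (Set.Subsingleton.isPreconnected ?_) h1 (arc_nonsep hB hpB hzB)
    have : ∀ y ∈ (K ∪ A) ∩ B, y = b := by
      rintro y ⟨hy | hy, hy'⟩
      · exact (hKS ⟨hy, hBS hy'⟩).elim (fun h => absurd hy' (by rw [h]; exact haB)) id
      · exact absurd hy' (disjoint_left.1 hd hy)
    exact fun y hy w hw => (this y hy).trans (this w hw).symm
  refine stay hcl hp ?_ h2
  intro y hy
  rcases frontier_comp hcl hy with h | h
  · exact Or.inl (Or.inl h)
  · rcases hcov h with (h | h) | h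
    · exact Or.inl (Or.inr h)
    · exact Or.inr h
    · exact absurd hy.1 h

lemma twoTouch (hK : IsCompact K) (hS : IsArc S a b) (hKS : K ∩ S ⊆ {a, b}) {p q : ℝ × ℝ}
    (hp : p ∉ S) (hq : q ∉ S) (h : Same K p q) (hn : ¬ Same (K ∪ S) p q) :
    S ⊆ frontier (connectedComponentIn (K ∪ S)ᶜ p) := by
  refine hS.subset_closure.trans (closure_minimal ?_ isClosed_frontier)
  intro x hx
  by_contra hxp
  exact hn (pull hK hS hKS hx (fun h' => h'.elim h.left hp) hxp h (Or.inl hq))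

lemma notMem_of_int (hKS : K ∩ S ⊆ {a, b}) {x : ℝ × ℝ} (hx : x ∈ S \ {a, b}) : x ∉ K :=
  fun h => hx.2 (hKS ⟨h, hx.1⟩)

lemma touchAll (hK : IsCompact K) (hS : IsArc S a b) (hKS : K ∩ S ⊆ {a, b}) {p y : ℝ × ℝ}
    (hp : p ∉ K ∪ S) (hy : y ∈ S \ {a, b}) (hyp : y ∈ frontier (connectedComponentIn (K ∪ S)ᶜ p)) :
    S ⊆ frontier (connectedComponentIn (K ∪ S)ᶜ p) := by
  refine hS.subset_closure.trans (closure_minimal ?_ isClosed_frontier)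
  intro x hx
  by_contra hxp
  have h1 : Same K p y := touchPt hp subset_union_left hyp.1 (notMem_of_int hKS hy)
  have h2 : Same K y x := Same.of_conn (hS.diff_conn (T := {a, b}) inter_subset_right)
    (disjoint_left.2 fun z hz => notMem_of_int hKS hz) hy hx
  exact (pull hK hS hKS hx hp hxp (h1.trans h2) (Or.inr rfl)).right (Or.inr hx.1)

/-- Two points near `x` separated by the closed curve `B ∪ S`. -/
lemma near {B : Set (ℝ × ℝ)} (hB : IsCompact B) (hS : IsArc S a b) (hBS : B ∩ S ⊆ {a, b})
    (hns : ∀ p q, p ∉ B → q ∉ B → Same B p q) (hsep : ∃ p q, p ∉ B ∪ S ∧ q ∉ B ∪ S ∧ ¬ Same (B ∪ S) p q)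
    {x : ℝ × ℝ} (hx : x ∈ S) {V : Set (ℝ × ℝ)} (hV : IsOpen V) (hxV : x ∈ V) :
    ∃ p ∈ V, ∃ q ∈ V, p ∉ B ∪ S ∧ q ∉ B ∪ S ∧ ¬ Same (B ∪ S) p q := by
  obtain ⟨p, q, hp, hq, hpq⟩ := hsep
  rw [mem_union, not_or] at hp hq
  have h1 := twoTouch hB hS hBS hp.2 hq.2 (hns p q hp.1 hq.1) hpq hx
  have h2 := twoTouch hB hS hBS hq.2 hp.2 (hns q p hq.1 hp.1) (fun h => hpq h.symm) hx
  obtain ⟨p', hp'V, hp'⟩ := mem_closure_iff.1 h1.1 V hV hxV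
  obtain ⟨q', hq'V, hq'⟩ := mem_closure_iff.1 h2.1 V hV hxV
  have hp'' : Same (B ∪ S) p p' := hp'
  have hq'' : Same (B ∪ S) q q' := hq'
  exact ⟨p', hp'V, q', hq'V, hp''.right, hq''.right, fun h => hpq (hp''.trans (h.trans hq''.symm))⟩

lemma exists_ball (hK : IsCompact K) {x : ℝ × ℝ} (hx : x ∉ K) :
    ∃ V, IsOpen V ∧ x ∈ V ∧ Disjoint V K ∧ IsPreconnected V := by
  obtain ⟨r, hr, h⟩ := Metric.isOpen_iff.1 hK.isClosed.isOpen_compl x hx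
  exact ⟨Metric.ball x r, Metric.isOpen_ball, Metric.mem_ball_self hr,
    subset_compl_iff_disjoint_right.1 h, (convex_ball x r).isPreconnected⟩

lemma crossing {B : Set (ℝ × ℝ)} (hK : IsCompact K) (hB : IsCompact B) (hBK : B ⊆ K) (hS : IsArc S a b)
    (hKS : K ∩ S ⊆ {a, b})
    (hns : ∀ p q, p ∉ B → q ∉ B → Same B p q) (hsep : ∃ p q, p ∉ B ∪ S ∧ q ∉ B ∪ S ∧ ¬ Same (B ∪ S) p q)
    {x p q : ℝ × ℝ} (hx : x ∈ S \ {a, b}) (hp : p ∉ K ∪ S) (hq : q ∉ K ∪ S) (hpq : ¬ Same (K ∪ S) p q)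
    (hxp : x ∈ frontier (connectedComponentIn (K ∪ S)ᶜ p))
    (hxq : x ∈ frontier (connectedComponentIn (K ∪ S)ᶜ q)) : ¬ Same (B ∪ S) p q := by
  have hxK := notMem_of_int hKS hx
  obtain ⟨V, hV, hxV, hVK, hVc⟩ := exists_ball hK hxK
  obtain ⟨g, hgV, h, hhV, hg, hh, hgh⟩ := near hB hS ((inter_subset_inter_left _ hBK).trans hKS) hns hsep hx.1 hV hxV
  have hsub : B ∪ S ⊆ K ∪ S := union_subset_union_left _ hBK
  rw [mem_union, not_or] at hg hh
  have e1 : Same K g x := Same.of_conn hVc hVK hgV hxV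
  have e2 : Same K h x := Same.of_conn hVc hVK hhV hxV
  have e3 : Same K p x := touchPt hp subset_union_left hxp.1 hxK
  have e4 : Same K q x := touchPt hq subset_union_left hxq.1 hxK
  have hpS : p ∉ S := fun h => hp (Or.inr h)
  have hqS : q ∉ S := fun h => hq (Or.inr h)
  have aux : ∀ p, Same K p x → p ∉ S → Same (K ∪ S) g p ∨ Same (K ∪ S) h p := by
    intro p e hpS
    rcases maxTwo hK hS hKS (e1.trans e2.symm) (e1.trans e.symm) hg.2 hh.2 hpS with h | h | h
    · exact absurd (h.mono hsub) hgh
    · exact Or.inl h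
    · exact Or.inr h
  intro hs
  rcases aux p e3 hpS with h1 | h1 <;> rcases aux q e4 hqS with h2 | h2
  · exact hpq (h1.symm.trans h2)
  · exact hgh ((h1.mono hsub).trans (hs.trans (h2.mono hsub).symm))
  · exact hgh ((h2.mono hsub).trans (hs.symm.trans (h1.mono hsub).symm))
  · exact hpq (h1.symm.trans h2)

end derived
end Pl


namespace Pl

/-- An arc, or a single point. -/
def WArc (S : Set (ℝ × ℝ)) (a b : ℝ × ℝ) : Prop := IsArc S a b ∨ (a = b ∧ S = {a})

lemma WArc.symm {S a b} (h : WArc S a b) : WArc S b a :=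
  h.elim (fun h => Or.inl h.symm) (fun h => Or.inr ⟨h.1.symm, h.1 ▸ h.2⟩)

lemma WArc.left_mem {S a b} (h : WArc S a b) : a ∈ S :=
  h.elim (fun h => h.left_mem) (fun h => h.2 ▸ rfl)

lemma WArc.right_mem {S a b} (h : WArc S a b) : b ∈ S := h.symm.left_mem

lemma WArc.conn {S a b} (h : WArc S a b) : IsPreconnected S :=
  h.elim (fun h => h.conn) (fun h => h.2 ▸ isPreconnected_singleton)

lemma WArc.arc {S a b} (h : WArc S a b) (hab : a ≠ b) : IsArc S a b :=
  h.elim id (fun h => absurd h.1 hab)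

lemma WArc.compact {S a b} (h : WArc S a b) : IsCompact S :=
  h.elim (fun h => h.compact) (fun h => h.2 ▸ isCompact_singleton)

lemma WArc.concat {S T a b c} (hS : WArc S a b) (hT : WArc T b c) (h : ∀ x ∈ S, x ∈ T → x = b) :
    WArc (S ∪ T) a c := by
  rcases hS with hS | ⟨rfl, rfl⟩
  · rcases hT with hT | ⟨rfl, rfl⟩
    · exact Or.inl (hS.concat hT (fun x hx => h x hx.1 hx.2))
    · rw [union_eq_left.2 (singleton_subset_iff.2 hS.right_mem)]
      exact Or.inl hS
  · rw [union_eq_right.2 (singleton_subset_iff.2 hT.left_mem)]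
    exact hT

/-- Configuration around one variable. -/
structure Cfg (P e L R X Y l r : Set (ℝ × ℝ)) (s t a b : ℝ × ℝ) : Prop where
  hP : IsArc P s t
  he : IsArc e s t
  hX : IsArc X a b
  hY : IsArc Y a b
  hl : WArc l s a
  hr : WArc r b t
  hlL : l ⊆ L
  hrR : r ⊆ R
  cL : IsCompact L
  cR : IsCompact R
  hLs : IsPreconnected (L \ {s})
  hLa : IsPreconnected (L \ {a})
  hRt : IsPreconnected (R \ {t})
  hRb : IsPreconnected (R \ {b})
  dL : s = a → L = {a}
  dR : t = b → R = {b}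
  iPe : ∀ x ∈ P, x ∈ e → x = s ∨ x = t
  iXY : ∀ x ∈ X, x ∈ Y → x = a ∨ x = b
  iLC : ∀ x ∈ L, x ∈ P ∪ e → x = s
  iRC : ∀ x ∈ R, x ∈ P ∪ e → x = t
  iLX : ∀ x ∈ L, x ∈ X ∪ Y → x = a
  iRX : ∀ x ∈ R, x ∈ X ∪ Y → x = b
  iLR : ∀ x ∈ L, x ∉ R
  iXC : ∀ x ∈ X ∪ Y, x ∈ P ∪ e → (x = s ∧ x = a) ∨ (x = t ∧ x = b)
  hd : ¬ (s = a ∧ t = b)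

/-- A face bounded by a closed curve made of two arcs, with the rest `M` on the other side. -/
lemma face_of {A B M : Set (ℝ × ℝ)} {a b d : ℝ × ℝ} (hA : IsArc A a b) (hB : IsArc B a b) (hAB : A ∩ B ⊆ {a, b})
    (hM : IsPreconnected M) (hd : d ∈ M) (hMd : Disjoint M (A ∪ B)) :
    ∃ p, p ∉ A ∪ B ∪ M ∧ connectedComponentIn (A ∪ B ∪ M)ᶜ p = connectedComponentIn (A ∪ B)ᶜ p ∧
      frontier (connectedComponentIn (A ∪ B ∪ M)ᶜ p) = A ∪ B := by
  obtain ⟨p, q, hp, hq, hpq, hpd⟩ : ∃ p q, p ∉ A ∪ B ∧ q ∉ A ∪ B ∧ ¬ Same (A ∪ B) p q ∧ ¬ Same (A ∪ B) p d := by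
    obtain ⟨p, q, hp, hq, hpq⟩ := jordan hA hB hAB
    by_cases h : Same (A ∪ B) p d
    · exact ⟨q, p, hq, hp, fun h' => hpq h'.symm, fun h' => hpq (h.trans h'.symm)⟩
    · exact ⟨p, q, hp, hq, hpq, h⟩
  have hmis : ∀ z, Same (A ∪ B) p z → z ∉ M := fun z hz hzM =>
    hpd (hz.trans (Same.of_conn hM hMd hzM hd))
  have hpM : p ∉ A ∪ B ∪ M := fun h => h.elim hp (hmis p (Same.refl hp))
  have heq : connectedComponentIn (A ∪ B ∪ M)ᶜ p = connectedComponentIn (A ∪ B)ᶜ p := by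
    apply Subset.antisymm
    · exact connectedComponentIn_mono _ (compl_subset_compl.2 subset_union_left)
    · refine isPreconnected_connectedComponentIn.subset_connectedComponentIn (mem_connectedComponentIn hp) ?_
      intro z hz h
      exact h.elim (connectedComponentIn_subset _ _ hz) (hmis z hz)
  refine ⟨p, hpM, heq, ?_⟩
  rw [heq]
  rw [mem_union, not_or] at hp hq
  apply Subset.antisymm
  · exact frontier_comp (hA.compact.union hB.compact).isClosed
  · refine union_subset ?_ ?_
    · have := twoTouch (p := p) (q := q) hB.compact hA (by rwa [inter_comm]) hp.1 hq.1 (arc_nonsep hB hp.2 hq.2) (by rwa [union_comm])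
      rwa [union_comm] at this
    · exact twoTouch (p := p) (q := q) hA.compact hB hAB hp.2 hq.2 (arc_nonsep hA hp.1 hq.1) hpq

namespace Cfg
variable {P e L R X Y l r : Set (ℝ × ℝ)} {s t a b : ℝ × ℝ}

lemma rev (h : Cfg P e L R X Y l r s t a b) : Cfg P e R L X Y r l t s b a where
  hP := h.hP.symm
  he := h.he.symm
  hX := h.hX.symm
  hY := h.hY.symm
  hl := h.hr.symm
  hr := h.hl.symm
  hlL := h.hrR
  hrR := h.hlL
  cL := h.cR
  cR := h.cL
  hLs := h.hRt
  hLa := h.hRb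
  hRt := h.hLs
  hRb := h.hLa
  dL := h.dR
  dR := h.dL
  iPe := fun x hx hy => (h.iPe x hx hy).symm
  iXY := fun x hx hy => (h.iXY x hx hy).symm
  iLC := h.iRC
  iRC := h.iLC
  iLX := h.iRX
  iRX := h.iLX
  iLR := fun x hx hy => h.iLR x hy hx
  iXC := fun x hx hy => (h.iXC x hx hy).symm
  hd := fun hh => h.hd ⟨hh.2, hh.1⟩

variable (h : Cfg P e L R X Y l r s t a b)
include h

lemma sL : s ∈ L := h.hlL h.hl.left_mem
lemma aL : a ∈ L := h.hlL h.hl.right_mem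
lemma bR : b ∈ R := h.hrR h.hr.left_mem
lemma tR : t ∈ R := h.hrR h.hr.right_mem

lemma connL : IsPreconnected L := by
  by_cases hsa : s = a
  · rw [h.dL hsa]; exact isPreconnected_singleton
  · have : L = (L \ {s}) ∪ l := by
      ext x
      by_cases hx : x = s
      · subst hx; simp [h.sL, h.hl.left_mem]
      · simp only [mem_union, mem_sdiff, mem_singleton_iff, hx, not_false_eq_true, and_true]
        exact ⟨Or.inl, fun h' => h'.elim id (fun h' => h.hlL h')⟩
    rw [this]
    exact h.hLs.union a ⟨h.aL, fun h' => hsa h'.symm⟩ h.hl.right_mem h.hl.conn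

lemma connR : IsPreconnected R := h.rev.connL

lemma ne_at : a ≠ t := fun hh => h.iLR a h.aL (hh ▸ h.tR)
lemma ne_sb : s ≠ b := fun hh => h.iLR s h.sL (hh ▸ h.bR)

lemma connD : IsPreconnected ((L ∪ R ∪ (X ∪ Y)) \ (P ∪ e)) := by
  have main : ∀ {L R X Y l r : Set (ℝ × ℝ)} {s t a b : ℝ × ℝ}, Cfg P e L R X Y l r s t a b → s ≠ a →
      IsPreconnected ((L ∪ R ∪ (X ∪ Y)) \ (P ∪ e)) := by
    intro L R X Y l r s t a b h hsa
    have haC : a ∉ P ∪ e := fun h' => hsa (h.iLC a h.aL h').symm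
    have hX : IsPreconnected (X \ (P ∪ e)) := h.hX.diff_conn (fun x hx => by
      rcases h.iXC x (Or.inl hx.1) hx.2 with h1 | h1 <;> simp [h1.2])
    have hY : IsPreconnected (Y \ (P ∪ e)) := h.hY.diff_conn (fun x hx => by
      rcases h.iXC x (Or.inr hx.1) hx.2 with h1 | h1 <;> simp [h1.2])
    have hL : L \ (P ∪ e) = L \ {s} := by
      ext x
      refine and_congr_right fun hx => not_congr ⟨fun h' => h.iLC x hx h', ?_⟩
      rintro rfl
      exact Or.inl h.hP.left_mem
    have hR : R \ (P ∪ e) = R \ {t} := by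
      ext x
      refine and_congr_right fun hx => not_congr ⟨fun h' => h.iRC x hx h', ?_⟩
      rintro rfl
      exact Or.inl h.hP.right_mem
    have h1 : IsPreconnected (L \ (P ∪ e) ∪ X \ (P ∪ e) ∪ Y \ (P ∪ e)) :=
      (IsPreconnected.union (s := L \ (P ∪ e)) (t := X \ (P ∪ e)) a ⟨h.aL, haC⟩ ⟨h.hX.left_mem, haC⟩ (hL ▸ h.hLs) hX).union a (Or.inl ⟨h.aL, haC⟩)
        ⟨h.hY.left_mem, haC⟩ hY
    have h2 : IsPreconnected (L \ (P ∪ e) ∪ X \ (P ∪ e) ∪ Y \ (P ∪ e) ∪ R \ (P ∪ e)) := by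
      by_cases htb : t = b
      · have : R \ (P ∪ e) = ∅ := by rw [hR, h.dR htb, htb]; simp
        rw [this, union_empty]; exact h1
      · have hbC : b ∉ P ∪ e := fun h' => htb (h.iRC b h.bR h').symm
        exact h1.union b (Or.inl (Or.inr ⟨h.hX.right_mem, hbC⟩)) ⟨h.bR, hbC⟩ (hR ▸ h.hRt)
    convert h2 using 1
    ext x; simp only [mem_union, mem_sdiff]; tauto
  by_cases hsa : s = a
  · have := main h.rev (fun hh => h.hd ⟨hsa, hh⟩)
    rwa [union_comm R L] at this
  · exact main h hsa

lemma connM : IsPreconnected ((P ∪ e ∪ L ∪ R) \ (X ∪ Y)) := by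
  have main : ∀ {L R X Y l r : Set (ℝ × ℝ)} {s t a b : ℝ × ℝ}, Cfg P e L R X Y l r s t a b → s ≠ a →
      IsPreconnected ((P ∪ e ∪ L ∪ R) \ (X ∪ Y)) := by
    intro L R X Y l r s t a b h hsa
    have hs : s ∉ X ∪ Y := fun h' => hsa (h.iLX s h.sL h')
    have hP : IsPreconnected (P \ (X ∪ Y)) := h.hP.diff_conn (fun x hx => by
      rcases h.iXC x hx.2 (Or.inl hx.1) with h1 | h1 <;> simp [h1.1])
    have he : IsPreconnected (e \ (X ∪ Y)) := h.he.diff_conn (fun x hx => by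
      rcases h.iXC x hx.2 (Or.inr hx.1) with h1 | h1 <;> simp [h1.1])
    have hL : L \ (X ∪ Y) = L \ {a} := by
      ext x
      refine and_congr_right fun hx => not_congr ⟨fun h' => h.iLX x hx h', ?_⟩
      rintro rfl
      exact Or.inl h.hX.left_mem
    have hR : R \ (X ∪ Y) = R \ {b} := by
      ext x
      refine and_congr_right fun hx => not_congr ⟨fun h' => h.iRX x hx h', ?_⟩
      rintro rfl
      exact Or.inl h.hX.right_mem
    have h1 : IsPreconnected (L \ (X ∪ Y) ∪ P \ (X ∪ Y) ∪ e \ (X ∪ Y)) :=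
      (IsPreconnected.union (s := L \ (X ∪ Y)) (t := P \ (X ∪ Y)) s ⟨h.sL, hs⟩ ⟨h.hP.left_mem, hs⟩ (hL ▸ h.hLa) hP).union s (Or.inl ⟨h.sL, hs⟩)
        ⟨h.he.left_mem, hs⟩ he
    have h2 : IsPreconnected (L \ (X ∪ Y) ∪ P \ (X ∪ Y) ∪ e \ (X ∪ Y) ∪ R \ (X ∪ Y)) := by
      by_cases htb : t = b
      · have : R \ (X ∪ Y) = ∅ := by rw [hR, h.dR htb]; simp
        rw [this, union_empty]; exact h1
      · have hbC : t ∉ X ∪ Y := fun h' => htb (h.iRX t h.tR h')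
        exact h1.union t (Or.inl (Or.inr ⟨h.hP.right_mem, hbC⟩)) ⟨h.tR, hbC⟩ (hR ▸ h.hRb)
    convert h2 using 1
    ext x; simp only [mem_union, mem_sdiff]; tauto
  by_cases hsa : s = a
  · have := main h.rev (fun hh => h.hd ⟨hsa, hh⟩)
    rwa [union_assoc, union_comm R L, ← union_assoc] at this
  · exact main h hsa

lemma nonemptyD : ((L ∪ R ∪ (X ∪ Y)) \ (P ∪ e)).Nonempty := by
  by_cases hsa : s = a
  · refine ⟨b, Or.inl (Or.inr h.bR), fun h' => h.hd ⟨hsa, (h.iRC b h.bR h').symm⟩⟩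
  · exact ⟨a, Or.inl (Or.inl h.aL), fun h' => hsa (h.iLC a h.aL h').symm⟩

lemma compact1 : IsCompact (e ∪ (L ∪ R ∪ (X ∪ Y))) :=
  h.he.compact.union ((h.cL.union h.cR).union (h.hX.compact.union h.hY.compact))

lemma compactK : IsCompact (e ∪ (L ∪ R ∪ (X ∪ Y)) ∪ P) := h.compact1.union h.hP.compact

lemma inter1 : (e ∪ (L ∪ R ∪ (X ∪ Y))) ∩ P ⊆ {s, t} := by
  rintro x ⟨h1 | (h1 | h1) | h1, h2⟩
  · exact h.iPe x h2 h1
  · exact Or.inl (h.iLC x h1 (Or.inl h2))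
  · exact Or.inr (h.iRC x h1 (Or.inl h2))
  · exact (h.iXC x h1 (Or.inl h2)).imp (fun h => h.1) (fun h => h.1)

/-- The face bounded by the cycle. -/
lemma exP : ∃ p, p ∉ e ∪ (L ∪ R ∪ (X ∪ Y)) ∪ P ∧
    frontier (connectedComponentIn (e ∪ (L ∪ R ∪ (X ∪ Y)) ∪ P)ᶜ p) = P ∪ e := by
  obtain ⟨d, hd⟩ := h.nonemptyD
  obtain ⟨p, h1, -, h2⟩ := face_of h.hP h.he (fun x hx => h.iPe x hx.1 hx.2) h.connD hd disjoint_sdiff_left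
  have : P ∪ e ∪ (L ∪ R ∪ (X ∪ Y)) \ (P ∪ e) = e ∪ (L ∪ R ∪ (X ∪ Y)) ∪ P := by
    rw [union_sdiff_self]; ext x; simp only [mem_union]; tauto
  rw [this] at h1 h2
  exact ⟨p, h1, h2⟩

lemma sameP {p x z : ℝ × ℝ} (hp : p ∉ e ∪ (L ∪ R ∪ (X ∪ Y)) ∪ P) (hx : x ∈ P \ {s, t})
    (hxp : x ∈ frontier (connectedComponentIn (e ∪ (L ∪ R ∪ (X ∪ Y)) ∪ P)ᶜ p)) (hz : z ∈ P \ {s, t}) :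
    Same (e ∪ (L ∪ R ∪ (X ∪ Y))) p z := by
  refine (touchPt hp subset_union_left hxp.1 (notMem_of_int h.inter1 hx)).trans ?_
  exact Same.of_conn (h.hP.diff_conn (T := {s, t}) inter_subset_right)
    (disjoint_left.2 fun z hz => notMem_of_int h.inter1 hz) hx hz

lemma exPint : (P \ {s, t}).Nonempty := by
  have := h.hP.subset_closure h.hP.left_mem
  exact closure_nonempty_iff.1 ⟨_, this⟩

lemma exQ {p : ℝ × ℝ} (hp : p ∉ e ∪ (L ∪ R ∪ (X ∪ Y)) ∪ P)
    (hpf : frontier (connectedComponentIn (e ∪ (L ∪ R ∪ (X ∪ Y)) ∪ P)ᶜ p) = P ∪ e) :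
    ∃ q, q ∉ e ∪ (L ∪ R ∪ (X ∪ Y)) ∪ P ∧ ¬ Same (e ∪ (L ∪ R ∪ (X ∪ Y)) ∪ P) p q ∧
      P ⊆ frontier (connectedComponentIn (e ∪ (L ∪ R ∪ (X ∪ Y)) ∪ P)ᶜ q) := by
  obtain ⟨x, hx⟩ := h.exPint
  have hpx : Same (e ∪ (L ∪ R ∪ (X ∪ Y))) p x := h.sameP hp hx (hpf ▸ Or.inl hx.1) hx
  obtain ⟨V, hV, hxV, hVK, hVc⟩ := exists_ball h.compact1 hpx.right
  have heP : e ∩ P ⊆ {s, t} := fun x hx => h.iPe x hx.2 hx.1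
  obtain ⟨g, hgV, k, hkV, hg, hk, hgk⟩ := near h.he.compact h.hP heP (fun p q hp hq => arc_nonsep h.he hp hq)
    (jordan h.he h.hP heP) hx.1 hV hxV
  have aux : ∀ g ∈ V, g ∉ e ∪ P → ¬ Same (e ∪ (L ∪ R ∪ (X ∪ Y)) ∪ P) p g → ∃ q, q ∉ e ∪ (L ∪ R ∪ (X ∪ Y)) ∪ P ∧ ¬ Same (e ∪ (L ∪ R ∪ (X ∪ Y)) ∪ P) p q ∧
      P ⊆ frontier (connectedComponentIn (e ∪ (L ∪ R ∪ (X ∪ Y)) ∪ P)ᶜ q) := by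
    intro g hgV hg hn
    have hgP : g ∉ P := fun h => hg (Or.inr h)
    refine ⟨g, fun h' => h'.elim (disjoint_left.1 hVK hgV) hgP, hn, ?_⟩
    refine twoTouch (q := p) h.compact1 h.hP h.inter1 hgP (fun h' => hp (Or.inr h')) ?_ (fun h' => hn h'.symm)
    exact (Same.of_conn hVc hVK hgV hxV).trans hpx.symm
  have hsub : e ∪ P ⊆ e ∪ (L ∪ R ∪ (X ∪ Y)) ∪ P := union_subset_union_left _ subset_union_left
  by_cases h1 : Same (e ∪ (L ∪ R ∪ (X ∪ Y)) ∪ P) p g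
  · exact aux k hkV hk (fun h2 => hgk ((h1.symm.trans h2).mono hsub))
  · exact aux g hgV hg h1

lemma uniqQ {p q q' y y' : ℝ × ℝ} (hp : p ∉ e ∪ (L ∪ R ∪ (X ∪ Y)) ∪ P)
    (hpf : frontier (connectedComponentIn (e ∪ (L ∪ R ∪ (X ∪ Y)) ∪ P)ᶜ p) = P ∪ e)
    (hq : q ∉ e ∪ (L ∪ R ∪ (X ∪ Y)) ∪ P) (hpq : ¬ Same (e ∪ (L ∪ R ∪ (X ∪ Y)) ∪ P) p q)
    (hq' : q' ∉ e ∪ (L ∪ R ∪ (X ∪ Y)) ∪ P) (hpq' : ¬ Same (e ∪ (L ∪ R ∪ (X ∪ Y)) ∪ P) p q')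
    (hy : y ∈ P \ {s, t}) (hyq : y ∈ frontier (connectedComponentIn (e ∪ (L ∪ R ∪ (X ∪ Y)) ∪ P)ᶜ q))
    (hy' : y' ∈ P \ {s, t}) (hyq' : y' ∈ frontier (connectedComponentIn (e ∪ (L ∪ R ∪ (X ∪ Y)) ∪ P)ᶜ q')) :
    Same (e ∪ (L ∪ R ∪ (X ∪ Y)) ∪ P) q q' := by
  have h1 := h.sameP hp hy (hpf ▸ Or.inl hy.1) hy
  have h2 := h.sameP hq hy hyq hy
  have h3 := h.sameP hq' hy' hyq' hy
  rcases maxTwo h.compact1 h.hP h.inter1 (h1.trans h2.symm) (h1.trans h3.symm) (fun h' => hp (Or.inr h'))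
    (fun h' => hq (Or.inr h')) (fun h' => hq' (Or.inr h')) with h' | h' | h'
  · exact absurd h' hpq
  · exact absurd h' hpq'
  · exact h'

lemma interX : (P ∪ e ∪ L ∪ R ∪ Y) ∩ X ⊆ {a, b} := by
  rintro x ⟨((h1 | h1) | h1) | h1, h2⟩
  · exact (h.iXC x (Or.inl h2) h1).imp (fun h => h.2) (fun h => h.2)
  · exact Or.inl (h.iLX x h1 (Or.inl h2))
  · exact Or.inr (h.iRX x h1 (Or.inl h2))
  · exact h.iXY x h2 h1

lemma flip : Cfg P e L R Y X l r s t a b :=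
  { h with
    hX := h.hY
    hY := h.hX
    iXY := fun x hx hy => h.iXY x hy hx
    iLX := fun x hx hy => h.iLX x hx hy.symm
    iRX := fun x hx hy => h.iRX x hx hy.symm
    iXC := fun x hx hy => h.iXC x hx.symm hy }

lemma compactX : IsCompact (P ∪ e ∪ L ∪ R ∪ Y) :=
  (((h.hP.compact.union h.he.compact).union h.cL).union h.cR).union h.hY.compact

lemma not_both {q x0 x y : ℝ × ℝ} (hq : q ∉ e ∪ (L ∪ R ∪ (X ∪ Y)) ∪ P) (hx0 : x0 ∈ P \ {s, t})
    (hx0q : x0 ∈ frontier (connectedComponentIn (e ∪ (L ∪ R ∪ (X ∪ Y)) ∪ P)ᶜ q))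
    (hx : x ∈ X \ {a, b}) (hy : y ∈ Y \ {a, b})
    (hxq : x ∈ frontier (connectedComponentIn (e ∪ (L ∪ R ∪ (X ∪ Y)) ∪ P)ᶜ q))
    (hyq : y ∈ frontier (connectedComponentIn (e ∪ (L ∪ R ∪ (X ∪ Y)) ∪ P)ᶜ q)) : False := by
  have hx0J : x0 ∉ X ∪ Y := fun h' => by
    rcases h.iXC x0 h' (Or.inl hx0.1) with h1 | h1
    · exact hx0.2 (Or.inl h1.1)
    · exact hx0.2 (Or.inr h1.1)
  obtain ⟨g, hg, hg1, hg2⟩ := face_of h.hX h.hY (fun x hx => h.iXY x hx.1 hx.2) h.connM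
    (d := x0) ⟨Or.inl (Or.inl (Or.inl hx0.1)), hx0J⟩ disjoint_sdiff_left
  have hK : X ∪ Y ∪ (P ∪ e ∪ L ∪ R) \ (X ∪ Y) = P ∪ e ∪ L ∪ R ∪ Y ∪ X := by
    rw [union_sdiff_self]; ext x; simp only [mem_union]; tauto
  have hK' : e ∪ (L ∪ R ∪ (X ∪ Y)) ∪ P = P ∪ e ∪ L ∪ R ∪ Y ∪ X := by
    ext x; simp only [mem_union]; tauto
  rw [hK] at hg hg1 hg2
  rw [hK'] at hq hx0q hxq hyq
  have hgq : ¬ Same (P ∪ e ∪ L ∪ R ∪ Y ∪ X) g q := fun h' => by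
    rw [← h'.eq, hg2] at hx0q
    exact hx0J hx0q
  have hB : IsArc (l ∪ e ∪ r) a b := by
    refine ((h.hl.symm.concat (Or.inl h.he) (fun x hx hx' => h.iLC x (h.hlL hx) (Or.inr hx'))).concat h.hr.symm ?_).arc h.hX.ne
    rintro x (h1 | h1) h2
    · exact absurd (h.hrR h2) (h.iLR x (h.hlL h1))
    · exact h.iRC x (h.hrR h2) (Or.inr h1)
  have hQ : IsArc (l ∪ X ∪ r) s t := by
    refine ((h.hl.concat (Or.inl h.hX) (fun x hx hx' => h.iLX x (h.hlL hx) (Or.inl hx'))).concat h.hr ?_).arc h.hP.ne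
    rintro x (h1 | h1) h2
    · exact absurd (h.hrR h2) (h.iLR x (h.hlL h1))
    · exact h.iRX x (h.hrR h2) (Or.inl h1)
  have hsep : ∃ p q, p ∉ l ∪ e ∪ r ∪ X ∧ q ∉ l ∪ e ∪ r ∪ X ∧ ¬ Same (l ∪ e ∪ r ∪ X) p q := by
    have : l ∪ e ∪ r ∪ X = e ∪ (l ∪ X ∪ r) := by
      ext x; simp only [mem_union]; tauto
    rw [this]
    refine jordan h.he hQ ?_
    rintro x ⟨h1, (h2 | h2) | h2⟩
    · exact Or.inl (h.iLC x (h.hlL h2) (Or.inr h1))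
    · exact (h.iXC x (Or.inl h2) (Or.inr h1)).imp (fun h => h.1) (fun h => h.1)
    · exact Or.inr (h.iRC x (h.hrR h2) (Or.inr h1))
  have hsub : l ∪ e ∪ r ⊆ P ∪ e ∪ L ∪ R ∪ Y := by
    rintro x ((h1 | h1) | h1)
    · exact Or.inl (Or.inl (Or.inr (h.hlL h1)))
    · exact Or.inl (Or.inl (Or.inl (Or.inr h1)))
    · exact Or.inl (Or.inr (h.hrR h1))
  have hc := crossing h.compactX hB.compact hsub h.hX h.interX (fun p q hp hq => arc_nonsep hB hp hq) hsep hx hg hq hgq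
    (by rw [hg2]; exact Or.inl hx.1) hxq
  have hyn : y ∉ l ∪ e ∪ r ∪ X := by
    intro h'
    have hyL : y ∉ P ∪ e ∪ L ∪ R ∪ X := fun h' => hy.2 (h.flip.interX ⟨h', hy.1⟩)
    apply hyL
    rcases h' with ((h1 | h1) | h1) | h1
    · exact Or.inl (Or.inl (Or.inr (h.hlL h1)))
    · exact Or.inl (Or.inl (Or.inl (Or.inr h1)))
    · exact Or.inl (Or.inr (h.hrR h1))
    · exact Or.inr h1
  have hyg : y ∈ frontier (connectedComponentIn (P ∪ e ∪ L ∪ R ∪ Y ∪ X)ᶜ g) := by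
    rw [hg2]; exact Or.inr hy.1
  have hsub' := union_subset_union_left X hsub
  exact hc ((touchPt hg hsub' hyg.1 hyn).trans (touchPt hq hsub' hyq.1 hyn).symm)

lemma sameL {q x0 x : ℝ × ℝ} (hq : q ∉ e ∪ (L ∪ R ∪ (X ∪ Y)) ∪ P) (hx0 : x0 ∈ P \ {s, t})
    (hx0q : x0 ∈ frontier (connectedComponentIn (e ∪ (L ∪ R ∪ (X ∪ Y)) ∪ P)ᶜ q))
    (hx : x ∈ X \ {a, b}) : Same L q x := by
  have hx0L : x0 ∉ L := fun h' => hx0.2 (Or.inl (h.iLC x0 h' (Or.inl hx0.1)))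
  have h1 : Same L q x0 := touchPt hq (fun z hz => Or.inl (Or.inr (Or.inl (Or.inl hz)))) hx0q.1 hx0L
  have hXc : IsPreconnected (X \ {a}) := h.hX.diff_conn (fun x hx => Or.inl hx.2)
  have hPc : IsPreconnected (P \ {s}) := h.hP.diff_conn (fun x hx => Or.inl hx.2)
  have hb : b ∈ X \ {a} := ⟨h.hX.right_mem, fun h' => h.hX.ne h'.symm⟩
  have ht : t ∈ P \ {s} := ⟨h.hP.right_mem, fun h' => h.hP.ne h'.symm⟩
  have hW : IsPreconnected (X \ {a} ∪ R ∪ P \ {s}) :=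
    (hXc.union b hb h.bR h.connR).union t (Or.inr h.tR) ht hPc
  refine h1.trans (Same.of_conn hW ?_ (Or.inr ⟨hx0.1, fun h' => hx0.2 (Or.inl h')⟩)
    (Or.inl (Or.inl ⟨hx.1, fun h' => hx.2 (Or.inl h')⟩)))
  rw [disjoint_left]
  rintro z ((h1 | h1) | h1) h2
  · exact h1.2 (h.iLX z h2 (Or.inl h1.1))
  · exact h.iLR z h2 h1
  · exact h1.2 (h.iLC z h2 (Or.inl h1.1))

lemma front_miss {q x : ℝ × ℝ} (hq : q ∉ e ∪ (L ∪ R ∪ (X ∪ Y)) ∪ P) (hx : x ∈ X \ {a, b})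
    (hxq : x ∉ frontier (connectedComponentIn (e ∪ (L ∪ R ∪ (X ∪ Y)) ∪ P)ᶜ q)) :
    ∀ z ∈ frontier (connectedComponentIn (e ∪ (L ∪ R ∪ (X ∪ Y)) ∪ P)ᶜ q), z ∈ X → z = a ∨ z = b := by
  intro z hz hzX
  by_contra hn
  have hK' : e ∪ (L ∪ R ∪ (X ∪ Y)) ∪ P = P ∪ e ∪ L ∪ R ∪ Y ∪ X := by
    ext x; simp only [mem_union]; tauto
  rw [hK'] at hq hz hxq
  exact hxq (touchAll h.compactX h.hX h.interX hq ⟨hzX, hn⟩ hz hx.1)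

lemma some_touch {p q x0 x y : ℝ × ℝ} (hp : p ∉ e ∪ (L ∪ R ∪ (X ∪ Y)) ∪ P)
    (hpf : frontier (connectedComponentIn (e ∪ (L ∪ R ∪ (X ∪ Y)) ∪ P)ᶜ p) = P ∪ e)
    (hq : q ∉ e ∪ (L ∪ R ∪ (X ∪ Y)) ∪ P) (hpq : ¬ Same (e ∪ (L ∪ R ∪ (X ∪ Y)) ∪ P) p q)
    (hx0 : x0 ∈ P \ {s, t})
    (hx0q : x0 ∈ frontier (connectedComponentIn (e ∪ (L ∪ R ∪ (X ∪ Y)) ∪ P)ᶜ q))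
    (hx : x ∈ X \ {a, b}) (hy : y ∈ Y \ {a, b})
    (hxq : x ∉ frontier (connectedComponentIn (e ∪ (L ∪ R ∪ (X ∪ Y)) ∪ P)ᶜ q))
    (hyq : y ∉ frontier (connectedComponentIn (e ∪ (L ∪ R ∪ (X ∪ Y)) ∪ P)ᶜ q)) : False := by
  have hcl := h.compactK.isClosed
  have hxK : x ∈ e ∪ (L ∪ R ∪ (X ∪ Y)) ∪ P := Or.inl (Or.inr (Or.inr (Or.inl hx.1)))
  have heP : e ∩ P ⊆ {s, t} := fun x hx => h.iPe x hx.2 hx.1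
  have hxn : x ∉ P ∪ e ∪ L ∪ R ∪ Y := fun h' => hx.2 (h.interX ⟨h', hx.1⟩)
  have hxe : x ∉ e := fun h' => hxn (Or.inl (Or.inl (Or.inl (Or.inr h'))))
  have hxP : x ∉ P := fun h' => hxn (Or.inl (Or.inl (Or.inl (Or.inl h'))))
  have h1 : ¬ Same (e ∪ P) p q :=
    crossing h.compact1 h.he.compact subset_union_left h.hP h.inter1 (fun p q hp hq => arc_nonsep h.he hp hq)
      (jordan h.he h.hP heP) hx0 hp hq hpq (hpf ▸ Or.inl hx0.1) hx0q
  have h2 : ¬ Same (e ∪ P) p x := fun h' =>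
    (stay hcl hp (by rw [hpf, union_comm]) h').right hxK
  have hpe : p ∉ e := fun h' => hp (Or.inl (Or.inl h'))
  have hqe : q ∉ e := fun h' => hq (Or.inl (Or.inl h'))
  have h3 : Same (e ∪ P) q x := by
    rcases maxTwo h.he.compact h.hP heP (arc_nonsep h.he hpe hqe) (arc_nonsep h.he hpe hxe)
      (fun h' => hp (Or.inr h')) (fun h' => hq (Or.inr h')) hxP with h' | h' | h'
    · exact absurd h' h1
    · exact absurd h' h2
    · exact h'
  have hL : Same L q x := h.sameL hq hx0 hx0q hx
  have hR : Same R q x := by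
    refine h.rev.sameL (x0 := x0) (by rwa [union_comm R L]) (by rwa [pair_comm]) (by rwa [union_comm R L]) (by rwa [pair_comm])
  have h4 : Same (e ∪ P ∪ L) q x := by
    refine jan (h.he.compact.union h.hP.compact) h.cL (Set.Subsingleton.isPreconnected ?_) h3 hL
    have : ∀ y ∈ (e ∪ P) ∩ L, y = s := fun y hy => h.iLC y hy.2 hy.1.symm
    exact fun y hy w hw => (this y hy).trans (this w hw).symm
  have h5 : Same (e ∪ P ∪ L ∪ R) q x := by
    refine jan ((h.he.compact.union h.hP.compact).union h.cL) h.cR (Set.Subsingleton.isPreconnected ?_) h4 hR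
    have : ∀ y ∈ (e ∪ P ∪ L) ∩ R, y = t := by
      rintro y ⟨h1 | h1, h2⟩
      · exact h.iRC y h2 h1.symm
      · exact absurd h2 (h.iLR y h1)
    exact fun y hy w hw => (this y hy).trans (this w hw).symm
  refine (stay hcl hq ?_ h5).right hxK
  intro z hz
  have hab : z = a ∨ z = b → z ∈ e ∪ P ∪ L ∪ R := by
    rintro (rfl | rfl)
    · exact Or.inl (Or.inr h.aL)
    · exact Or.inr h.bR
  rcases frontier_comp hcl hz with (h' | (h' | h') | h' | h') | h'
  · exact Or.inl (Or.inl (Or.inl h'))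
  · exact Or.inl (Or.inr h')
  · exact Or.inr h'
  · exact hab (h.front_miss hq hx hxq z hz h')
  · rw [union_comm X Y] at hz hq hyq
    exact hab (h.flip.front_miss hq hy hyq z hz h')
  · exact Or.inl (Or.inl (Or.inr h'))

end Cfg
end Pl


namespace Pl

structure Config (n : ℕ) (U : ℕ → ℝ × ℝ) (X : ℕ → Bool → Set (ℝ × ℝ)) (P e : Set (ℝ × ℝ)) : Prop where
  hn : 2 ≤ n
  inj : ∀ i ≤ n, ∀ j ≤ n, U i = U j → i = j
  hX : ∀ i < n, ∀ b, IsArc (X i b) (U i) (U (i + 1))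
  hP : IsArc P (U 0) (U n)
  he : IsArc e (U 0) (U n)
  iPe : ∀ x ∈ P, x ∈ e → ∃ k ≤ n, x = U k
  iX : ∀ i < n, ∀ j < n, ∀ b b', (i ≠ j ∨ b ≠ b') → ∀ x ∈ X i b, x ∈ X j b' → ∃ k ≤ n, x = U k
  uX : ∀ i < n, ∀ j ≤ n, ∀ b, U j ∈ X i b → j = i ∨ j = i + 1
  iXC : ∀ i < n, ∀ b, ∀ x ∈ X i b, x ∈ P ∪ e → ∃ k ≤ n, x = U k
  uC : ∀ k ≤ n, U k ∈ P ∪ e → k = 0 ∨ k = n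

def chain (U : ℕ → ℝ × ℝ) (X : ℕ → Bool → Set (ℝ × ℝ)) (i : ℕ) : ℕ → Set (ℝ × ℝ)
  | 0 => {U i}
  | k + 1 => chain U X i k ∪ (X (i + k) true ∪ X (i + k) false)

def path (U : ℕ → ℝ × ℝ) (X : ℕ → Bool → Set (ℝ × ℝ)) (i : ℕ) : ℕ → Set (ℝ × ℝ)
  | 0 => {U i}
  | k + 1 => path U X i k ∪ X (i + k) true

section
variable {n : ℕ} {U : ℕ → ℝ × ℝ} {X : ℕ → Bool → Set (ℝ × ℝ)} {P e : Set (ℝ × ℝ)}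

lemma path_sub (i k : ℕ) : path U X i k ⊆ chain U X i k := by
  induction k with
  | zero => exact subset_rfl
  | succ k ih => exact union_subset_union ih subset_union_left

lemma chain_spec {i k : ℕ} {x : ℝ × ℝ} (hx : x ∈ chain U X i k) :
    x = U i ∨ ∃ j b, i ≤ j ∧ j < i + k ∧ x ∈ X j b := by
  induction k with
  | zero => exact Or.inl hx
  | succ k ih =>
    rcases hx with hx | hx | hx
    · rcases ih hx with h | ⟨j, b, h1, h2, h3⟩
      · exact Or.inl h
      · exact Or.inr ⟨j, b, h1, by omega, h3⟩
    · exact Or.inr ⟨i + k, true, by omega, by omega, hx⟩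
    · exact Or.inr ⟨i + k, false, by omega, by omega, hx⟩

lemma sub_chain {i k j : ℕ} {b : Bool} (h1 : i ≤ j) (h2 : j < i + k) : X j b ⊆ chain U X i k := by
  induction k with
  | zero => omega
  | succ k ih =>
    by_cases h : j = i + k
    · subst h
      cases b
      · exact fun x hx => Or.inr (Or.inr hx)
      · exact fun x hx => Or.inr (Or.inl hx)
    · exact fun x hx => Or.inl (ih (by omega) hx)

variable (h : Config n U X P e)
include h

lemma Config.chain_u {i k j : ℕ} (hik : i + k ≤ n) (hj : j ≤ n) (hx : U j ∈ chain U X i k) : i ≤ j ∧ j ≤ i + k := by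
  rcases chain_spec hx with h1 | ⟨j', b, h1, h2, h3⟩
  · have := h.inj j hj i (by omega) h1
    omega
  · have := h.uX j' (by omega) j hj b h3
    omega

lemma Config.chain_last {i k : ℕ} (hik : i + k ≤ n) : U (i + k) ∈ chain U X i k := by
  cases k with
  | zero => rfl
  | succ k => exact Or.inr (Or.inl (h.hX (i + k) (by omega) true).right_mem)

lemma Config.chain_first {i k : ℕ} : U i ∈ chain U X i k := by
  induction k with
  | zero => rfl
  | succ k ih => exact Or.inl ih

lemma Config.chain_compact {i k : ℕ} (hik : i + k ≤ n) : IsCompact (chain U X i k) := by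
  induction k with
  | zero => exact isCompact_singleton
  | succ k ih =>
    exact (ih (by omega)).union ((h.hX _ (by omega) true).compact.union (h.hX _ (by omega) false).compact)

lemma Config.path_warc {i k : ℕ} (hik : i + k ≤ n) : WArc (path U X i k) (U i) (U (i + k)) := by
  induction k with
  | zero => exact Or.inr ⟨rfl, rfl⟩
  | succ k ih =>
    refine (ih (by omega)).concat (Or.inl (h.hX (i + k) (by omega) true)) ?_
    intro x hx hx'
    rcases chain_spec (path_sub _ _ hx) with h1 | ⟨j, b, h1, h2, h3⟩
    · rw [h1] at hx' ⊢
      rcases h.uX (i + k) (by omega) i (by omega) true hx' with h2 | h2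
      · rw [← h2]
      · omega
    · obtain ⟨l, hl, rfl⟩ := h.iX j (by omega) (i + k) (by omega) b true (Or.inl (by omega)) x h3 hx'
      have e1 := h.uX j (by omega) l hl b h3
      have e2 := h.uX (i + k) (by omega) l hl _ hx'
      have : l = i + k := by omega
      rw [this]

lemma Config.chain_conn {i k : ℕ} (hik : i + k ≤ n) : IsPreconnected (chain U X i k) := by
  induction k with
  | zero => exact isPreconnected_singleton
  | succ k ih =>
    have h1 := h.hX (i + k) (by omega) true
    have h2 := h.hX (i + k) (by omega) false
    exact (ih (by omega)).union (U (i + k)) (h.chain_last (by omega)) (Or.inl h1.left_mem)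
      (h1.conn.union _ h1.left_mem h2.left_mem h2.conn)

lemma Config.chain_conn_first {i k : ℕ} (hik : i + k ≤ n) : IsPreconnected (chain U X i k \ {U i}) := by
  induction k with
  | zero => 
    have : chain U X i 0 \ {U i} = ∅ := by simp [chain]
    rw [this]; exact isPreconnected_empty
  | succ k ih =>
    have aux : ∀ b, X (i + k) b ∩ {U i} ⊆ {U (i + k), U (i + k + 1)} := by
      rintro b x ⟨hx, rfl⟩
      rcases h.uX (i + k) (by omega) i (by omega) b hx with h2 | h2
      · exact Or.inl (congrArg U h2)
      · exact Or.inr (congrArg U h2)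
    have h1 := h.hX (i + k) (by omega) true
    have h2 := h.hX (i + k) (by omega) false
    have hne : U (i + k + 1) ∉ ({U i} : Set (ℝ × ℝ)) := fun h' => by
      have := h.inj _ hik _ (by omega) h'
      omega
    have h3 : IsPreconnected (X (i + k) true \ {U i} ∪ X (i + k) false \ {U i}) :=
      (h1.diff_conn (aux _)).union _ ⟨h1.right_mem, hne⟩ ⟨h2.right_mem, hne⟩ (h2.diff_conn (aux _))
    rw [chain, union_sdiff_distrib, union_sdiff_distrib]
    by_cases hk : k = 0
    · subst hk
      have : chain U X i 0 \ {U i} = ∅ := by simp [chain]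
      rw [this, empty_union]
      exact h3
    · have hne : U (i + k) ∉ ({U i} : Set (ℝ × ℝ)) := fun h' => by
        have := h.inj _ (by omega) _ (by omega) h'
        omega
      exact (ih (by omega)).union (U (i + k)) ⟨h.chain_last (by omega), hne⟩ (Or.inl ⟨h1.left_mem, hne⟩) h3

lemma Config.chain_conn_last {i k : ℕ} (hik : i + k ≤ n) : IsPreconnected (chain U X i k \ {U (i + k)}) := by
  cases k with
  | zero => 
    have : chain U X i 0 \ {U (i + 0)} = ∅ := by simp [chain]
    rw [this]; exact isPreconnected_empty
  | succ k =>
    have h1 := h.hX (i + k) (by omega) true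
    have h2 := h.hX (i + k) (by omega) false
    have hne : U (i + k) ∉ ({U (i + k + 1)} : Set (ℝ × ℝ)) := fun h' => by
      have := h.inj _ (by omega) _ (by omega) h'
      omega
    have h3 : IsPreconnected (X (i + k) true \ {U (i + k + 1)} ∪ X (i + k) false \ {U (i + k + 1)}) :=
      (h1.diff_conn (fun x hx => Or.inr hx.2)).union _ ⟨h1.left_mem, hne⟩ ⟨h2.left_mem, hne⟩
        (h2.diff_conn (fun x hx => Or.inr hx.2))
    have h4 : chain U X i k \ {U (i + k + 1)} = chain U X i k := by
      refine sdiff_singleton_eq_self fun h' => ?_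
      have := h.chain_u (by omega) hik h'
      omega
    rw [← add_assoc, chain, union_sdiff_distrib, union_sdiff_distrib, h4]
    exact (h.chain_conn (by omega)).union (U (i + k)) (h.chain_last (by omega)) (Or.inl ⟨h1.left_mem, hne⟩) h3

end

lemma Config.cfg {i m : ℕ} {U : ℕ → ℝ × ℝ} {X : ℕ → Bool → Set (ℝ × ℝ)} {P e : Set (ℝ × ℝ)}
    (h : Config (i + 1 + m) U X P e) :
    Cfg P e (chain U X 0 i) (chain U X (i + 1) m) (X i true) (X i false) (path U X 0 i) (path U X (i + 1) m)
      (U 0) (U (i + 1 + m)) (U i) (U (i + 1)) where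
  hP := h.hP
  he := h.he
  hX := h.hX i (by omega) _
  hY := h.hX i (by omega) _
  hl := by simpa using h.path_warc (i := 0) (k := i) (by omega)
  hr := h.path_warc le_rfl
  hlL := path_sub _ _
  hrR := path_sub _ _
  cL := h.chain_compact (by omega)
  cR := h.chain_compact le_rfl
  hLs := h.chain_conn_first (by omega)
  hLa := by simpa using h.chain_conn_last (i := 0) (k := i) (by omega)
  hRt := h.chain_conn_last le_rfl
  hRb := h.chain_conn_first le_rfl
  dL := fun h' => by
    have := h.inj _ (by omega) _ (by omega) h'
    subst this; rfl
  dR := fun h' => by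
    have := h.inj _ (by omega) _ (by omega) h'
    have : m = 0 := by omega
    subst this; rfl
  iPe := fun x hx hx' => by
    obtain ⟨k, hk, rfl⟩ := h.iPe x hx hx'
    rcases h.uC k hk (Or.inl hx) with h1 | h1 <;> simp [h1]
  iXY := fun x hx hx' => by
    obtain ⟨k, hk, rfl⟩ := h.iX i (by omega) i (by omega) true false (by simp) x hx hx'
    rcases h.uX _ (by omega) k hk _ hx with h1 | h1 <;> simp [h1]
  iLC := fun x hx hx' => by
    rcases chain_spec hx with h1 | ⟨j, b, h1, h2, h3⟩
    · exact h1
    · obtain ⟨k, hk, rfl⟩ := h.iXC j (by omega) b x h3 hx'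
      have e1 := h.uX j (by omega) k hk b h3
      have e2 := h.uC k hk hx'
      have : k = 0 := by omega
      rw [this]
  iRC := fun x hx hx' => by
    rcases chain_spec hx with h1 | ⟨j, b, h1, h2, h3⟩
    · have e2 := h.uC (i + 1) (by omega) (h1 ▸ hx')
      have : m = 0 := by omega
      rw [h1, this]
    · obtain ⟨k, hk, rfl⟩ := h.iXC j (by omega) b x h3 hx'
      have e1 := h.uX j (by omega) k hk b h3
      have e2 := h.uC k hk hx'
      have : k = i + 1 + m := by omega
      rw [this]
  iLX := fun x hx hx' => by
    obtain ⟨b', hx'⟩ : ∃ b, x ∈ X i b := hx'.elim (fun h => ⟨_, h⟩) (fun h => ⟨_, h⟩)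
    rcases chain_spec hx with h1 | ⟨j, b, h1, h2, h3⟩
    · rw [h1] at hx' ⊢
      have e1 := h.uX i (by omega) 0 (by omega) _ hx'
      have : i = 0 := by omega
      rw [this]
    · obtain ⟨k, hk, rfl⟩ := h.iX j (by omega) i (by omega) b b' (Or.inl (by omega)) x h3 hx'
      have e1 := h.uX j (by omega) k hk b h3
      have e2 := h.uX i (by omega) k hk b' hx'
      have : k = i := by omega
      rw [this]
  iRX := fun x hx hx' => by
    obtain ⟨b', hx'⟩ : ∃ b, x ∈ X i b := hx'.elim (fun h => ⟨_, h⟩) (fun h => ⟨_, h⟩)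
    rcases chain_spec hx with h1 | ⟨j, b, h1, h2, h3⟩
    · exact h1
    · obtain ⟨k, hk, rfl⟩ := h.iX j (by omega) i (by omega) b b' (Or.inl (by omega)) x h3 hx'
      have e1 := h.uX j (by omega) k hk b h3
      have e2 := h.uX i (by omega) k hk b' hx'
      have : k = i + 1 := by omega
      rw [this]
  iLR := fun x hx hx' => by
    have aux : ∃ k ≤ i + 1 + m, x = U k := by
      rcases chain_spec hx with h1 | ⟨j, b, h1, h2, h3⟩
      · exact ⟨0, by omega, h1⟩
      rcases chain_spec hx' with h1' | ⟨j', b', h1', h2', h3'⟩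
      · exact ⟨i + 1, by omega, h1'⟩
      exact h.iX j (by omega) j' (by omega) b b' (Or.inl (by omega)) x h3 h3'
    obtain ⟨k, hk, rfl⟩ := aux
    have e1 := h.chain_u (by omega) hk hx
    have e2 := h.chain_u (by omega) hk hx'
    omega
  iXC := fun x hx hx' => by
    obtain ⟨b, hx⟩ : ∃ b, x ∈ X i b := hx.elim (fun h => ⟨_, h⟩) (fun h => ⟨_, h⟩)
    obtain ⟨k, hk, rfl⟩ := h.iXC i (by omega) b x hx hx'
    have e1 := h.uX i (by omega) k hk b hx
    have e2 := h.uC k hk hx'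
    rcases e2 with e2 | e2
    · have : k = i := by omega
      exact Or.inl ⟨by rw [e2], by rw [this]⟩
    · have : k = i + 1 := by omega
      exact Or.inr ⟨by rw [e2], by rw [this]⟩
  hd := fun ⟨h1, h2⟩ => by
    have e1 := h.inj _ (by omega) _ (by omega) h1
    have e2 := h.inj _ (by omega) _ (by omega) h2
    have := h.hn
    omega

lemma cfg_union {i m : ℕ} {U : ℕ → ℝ × ℝ} {X : ℕ → Bool → Set (ℝ × ℝ)} {P e : Set (ℝ × ℝ)}
    (h : Config (i + 1 + m) U X P e) :
    e ∪ (chain U X 0 i ∪ chain U X (i + 1) m ∪ (X i true ∪ X i false)) ∪ P =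
      P ∪ e ∪ {x | ∃ j < i + 1 + m, ∃ b, x ∈ X j b} := by
  ext x
  constructor
  · rintro ((h1 | (h1 | h1) | h1 | h1) | h1)
    · exact Or.inl (Or.inr h1)
    · rcases chain_spec h1 with h1 | ⟨j, b, h1, h2, h3⟩
      · rw [h1]; exact Or.inl (Or.inl h.hP.left_mem)
      · exact Or.inr ⟨j, by omega, b, h3⟩
    · rcases chain_spec h1 with h1 | ⟨j, b, h1, h2, h3⟩
      · rw [h1]; exact Or.inr ⟨i, by omega, true, (h.hX i (by omega) true).right_mem⟩
      · exact Or.inr ⟨j, by omega, b, h3⟩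
    · exact Or.inr ⟨i, by omega, _, h1⟩
    · exact Or.inr ⟨i, by omega, _, h1⟩
    · exact Or.inl (Or.inl h1)
  · rintro ((h1 | h1) | ⟨j, hj, b, h1⟩)
    · exact Or.inr h1
    · exact Or.inl (Or.inl h1)
    · refine Or.inl (Or.inr ?_)
      rcases lt_trichotomy j i with h2 | h2 | h2
      · exact Or.inl (Or.inl (sub_chain (by omega) (by omega) h1))
      · subst h2
        cases b
        · exact Or.inr (Or.inr h1)
        · exact Or.inr (Or.inl h1)
      · exact Or.inl (Or.inr (sub_chain (by omega) (by omega) h1))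

theorem config_main {n : ℕ} {U : ℕ → ℝ × ℝ} {X : ℕ → Bool → Set (ℝ × ℝ)} {P e K : Set (ℝ × ℝ)}
    (h : Config n U X P e) (hK : K = P ∪ e ∪ {x | ∃ j < n, ∃ b, x ∈ X j b}) :
    ∃ p, p ∉ K ∧ frontier (connectedComponentIn Kᶜ p) = P ∪ e ∧
      (∃ q, q ∉ K ∧ ¬ Same K p q ∧ P ⊆ frontier (connectedComponentIn Kᶜ q)) ∧
      (∀ q q' y y', q ∉ K → q' ∉ K → ¬ Same K p q → ¬ Same K p q' → y ∈ P \ {U 0, U n} → y' ∈ P \ {U 0, U n} →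
        y ∈ frontier (connectedComponentIn Kᶜ q) → y' ∈ frontier (connectedComponentIn Kᶜ q') → Same K q q') ∧
      (∀ q x0, q ∉ K → ¬ Same K p q → x0 ∈ P \ {U 0, U n} → x0 ∈ frontier (connectedComponentIn Kᶜ q) →
        ∀ i < n, ∀ x ∈ X i true \ {U i, U (i + 1)}, ∀ y ∈ X i false \ {U i, U (i + 1)},
          Xor' (x ∈ frontier (connectedComponentIn Kᶜ q)) (y ∈ frontier (connectedComponentIn Kᶜ q))) := by
  have hn := h.hn
  obtain ⟨m, rfl⟩ : ∃ m, n = 0 + 1 + m := ⟨n - 1, by omega⟩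
  have h0 := h.cfg
  have hu := (cfg_union h).trans hK.symm
  obtain ⟨p, hp, hpf⟩ := h0.exP
  refine ⟨p, hu ▸ hp, hu ▸ hpf, ?_, ?_, ?_⟩
  · have := h0.exQ hp hpf
    rwa [hu] at this
  · intro q q' y y' hq hq' hn hn' hy hy' hyq hyq'
    rw [← hu] at *
    exact h0.uniqQ hp hpf hq hn hq' hn' hy hyq hy' hyq'
  · rw [hu] at hp hpf
    clear hu h0
    intro q x0 hq hn hx0 hx0q i hi x hx y hy
    revert h hn hx0 hK
    obtain ⟨m', hm'⟩ : ∃ m', 0 + 1 + m = i + 1 + m' := ⟨m - i, by omega⟩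
    rw [hm']
    intro h hK hn hx0
    have h0 := h.cfg
    have hu := (cfg_union h).trans hK.symm
    rw [← hu] at hp hpf hq hn hx0q ⊢
    by_cases h1 : x ∈ frontier (connectedComponentIn (e ∪ (chain U X 0 i ∪ chain U X (i + 1) m' ∪ (X i true ∪ X i false)) ∪ P)ᶜ q)
    · exact Or.inl ⟨h1, fun h2 => h0.not_both hq hx0 hx0q hx hy h1 h2⟩
    · refine Or.inr ⟨?_, h1⟩
      by_contra h2
      exact h0.some_touch hp hpf hq hn hx0 hx0q hx hy h1 h2

end Pl

namespace Pl
section emb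
variable {V : Type*} {G : SimpleGraph V} (Φ : PlaneEmbedding G)

def AA (s : Sym2 V) : Set (ℝ × ℝ) := {x | ∃ h : s ∈ G.edgeSet, x ∈ Φ.arc ⟨s, h⟩}

def AE (E : Set (Sym2 V)) : Set (ℝ × ℝ) := {x | ∃ s ∈ E, x ∈ AA Φ s}

variable {Φ}

lemma AA_arc {u v : V} (h : G.Adj u v) : IsArc (AA Φ s(u, v)) (Φ.vmap u) (Φ.vmap v) := by
  have he : AA Φ s(u, v) = Φ.arc ⟨s(u, v), h⟩ := by
    ext x; exact ⟨fun ⟨_, h⟩ => h, fun h' => ⟨h, h'⟩⟩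
  rw [he]
  obtain ⟨f, hf, hi, hr, u', v', h1, h2, h3⟩ := Φ.arc_path ⟨s(u, v), h⟩
  have base : IsArc (Φ.arc ⟨s(u, v), h⟩) (Φ.vmap u') (Φ.vmap v') := ⟨f, hf, hi, hr, h2, h3⟩
  rcases Sym2.eq_iff.1 h1 with ⟨rfl, rfl⟩ | ⟨rfl, rfl⟩
  · exact base
  · exact base.symm

lemma AA_v {s : Sym2 V} {v : V} (h : Φ.vmap v ∈ AA Φ s) : v ∈ s := by
  obtain ⟨h1, h2⟩ := h
  exact Φ.vmap_mem_arc _ _ h2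

lemma AA_inter {s s' : Sym2 V} (hs : s ≠ s') {x : ℝ × ℝ} (h : x ∈ AA Φ s) (h' : x ∈ AA Φ s') :
    ∃ v, v ∈ s ∧ v ∈ s' ∧ x = Φ.vmap v := by
  obtain ⟨h1, h2⟩ := h
  obtain ⟨h1', h2'⟩ := h'
  obtain ⟨v, ⟨hv, hv'⟩, rfl⟩ := Φ.arc_inter ⟨s, h1⟩ ⟨s', h1'⟩ (fun h => hs (congrArg Subtype.val h)) ⟨h2, h2'⟩
  exact ⟨v, hv, hv', rfl⟩

lemma AE_v {E : Set (Sym2 V)} {v : V} (h : Φ.vmap v ∈ AE Φ E) : ∃ s ∈ E, v ∈ s := by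
  obtain ⟨s, hs, h⟩ := h
  exact ⟨s, hs, AA_v h⟩

lemma AE_inter {E E' : Set (Sym2 V)} (hE : ∀ s ∈ E, s ∉ E') {x : ℝ × ℝ} (h : x ∈ AE Φ E) (h' : x ∈ AE Φ E') :
    ∃ s ∈ E, ∃ s' ∈ E', ∃ v, v ∈ s ∧ v ∈ s' ∧ x = Φ.vmap v := by
  obtain ⟨s, hs, h⟩ := h
  obtain ⟨s', hs', h'⟩ := h'
  exact ⟨s, hs, s', hs', AA_inter (fun hh : s = s' => hE s hs (by rw [hh]; exact hs')) h h'⟩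

lemma AE_union (E E' : Set (Sym2 V)) : AE Φ (E ∪ E') = AE Φ E ∪ AE Φ E' := by
  ext x
  constructor
  · rintro ⟨s, hs | hs, h⟩
    · exact Or.inl ⟨s, hs, h⟩
    · exact Or.inr ⟨s, hs, h⟩
  · rintro (⟨s, hs, h⟩ | ⟨s, hs, h⟩)
    · exact ⟨s, Or.inl hs, h⟩
    · exact ⟨s, Or.inr hs, h⟩

lemma AE_singleton (s : Sym2 V) : AE Φ {s} = AA Φ s := by
  ext x
  constructor
  · rintro ⟨_, rfl, h⟩; exact h
  · intro h; exact ⟨s, rfl, h⟩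

def wE (w : ℕ → V) (k : ℕ) : Set (Sym2 V) := {s | ∃ j < k, s = s(w j, w (j + 1))}

lemma wE_succ (w : ℕ → V) (k : ℕ) : wE w (k + 1) = wE w k ∪ {s(w k, w (k + 1))} := by
  ext s
  constructor
  · rintro ⟨j, hj, rfl⟩
    rcases Nat.lt_succ_iff_lt_or_eq.1 hj with h | rfl
    · exact Or.inl ⟨j, h, rfl⟩
    · exact Or.inr rfl
  · rintro (⟨j, hj, rfl⟩ | rfl)
    · exact ⟨j, by omega, rfl⟩
    · exact ⟨k, by omega, rfl⟩

lemma walk_arc (w : ℕ → V) (k : ℕ) (hw : ∀ i ≤ k + 1, ∀ j ≤ k + 1, w i = w j → i = j)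
    (ha : ∀ j < k + 1, G.Adj (w j) (w (j + 1))) :
    IsArc (AE Φ (wE w (k + 1))) (Φ.vmap (w 0)) (Φ.vmap (w (k + 1))) := by
  induction k with
  | zero =>
    have : wE w (0 + 1) = {s(w 0, w (0 + 1))} := by
      rw [wE_succ]
      have : wE w 0 = ∅ := by ext s; simp [wE]
      rw [this, empty_union]
    rw [this, AE_singleton]
    exact AA_arc (ha 0 (by omega))
  | succ k ih =>
    rw [wE_succ, AE_union, AE_singleton]
    refine (ih (fun i hi j hj h => hw i (by omega) j (by omega) h) (fun j hj => ha j (by omega))).concat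
      (AA_arc (ha (k + 1) (by omega))) ?_
    rintro x ⟨⟨s, ⟨j, hj, rfl⟩, h1⟩, h2⟩
    have hne : s(w j, w (j + 1)) ≠ s(w (k + 1), w (k + 1 + 1)) := by
      intro h
      have : w (k + 1 + 1) ∈ s(w j, w (j + 1)) := h ▸ Sym2.mem_mk_right _ _
      rcases Sym2.mem_iff.1 this with h | h
      · have := hw _ (by omega) _ (by omega) h; omega
      · have := hw _ (by omega) _ (by omega) h; omega
    obtain ⟨v, hv, hv', rfl⟩ := AA_inter hne h1 h2
    rcases Sym2.mem_iff.1 hv' with rfl | rfl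
    · rfl
    · exfalso
      rcases Sym2.mem_iff.1 hv with h | h
      · have := hw _ (by omega) _ (by omega) h; omega
      · have := hw _ (by omega) _ (by omega) h; omega

end emb

section cnf
variable {n m : ℕ}

def uu (n m : ℕ) (i : ℕ) : CNFVtx n m := CNFVtx.u ⟨min i n, by omega⟩

def ll (n m : ℕ) (i : ℕ) (b : Bool) : CNFVtx n m := if h : i < n then CNFVtx.lit ⟨i, h⟩ b else uu n m 0

def ww (n m : ℕ) (j : ℕ) : CNFVtx n m :=
  if j = 0 then uu n m 0 else if h : j - 1 < m then CNFVtx.cl ⟨j - 1, h⟩ else uu n m n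

def XE (n m : ℕ) (i : ℕ) (b : Bool) : Set (Sym2 (CNFVtx n m)) :=
  {s(uu n m i, ll n m i b), s(ll n m i b, uu n m (i + 1))}

lemma ll_eq {i : ℕ} (h : i < n) (b : Bool) : ll n m i b = CNFVtx.lit ⟨i, h⟩ b := dif_pos h

lemma uu_castSucc (i : Fin n) : CNFVtx.u i.castSucc = uu n m i := by
  unfold uu; congr 1; ext; simp

lemma uu_succ (i : Fin n) : CNFVtx.u i.succ = uu n m (i + 1) := by
  unfold uu; congr 1; ext; simp

lemma uu_zero : CNFVtx.u 0 = uu n m 0 := by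
  unfold uu; congr 1

lemma uu_last : CNFVtx.u (Fin.last n) = uu n m n := by
  unfold uu; congr 1; ext; simp

lemma uu_inj {i j : ℕ} (hi : i ≤ n) (hj : j ≤ n) (h : uu n m i = uu n m j) : i = j := by
  have := CNFVtx.u.inj h
  have := congrArg Fin.val this
  simp only at this
  omega

lemma uu_ne_ll {i j : ℕ} (hi : i < n) (b : Bool) : uu n m j ≠ ll n m i b := by
  rw [ll_eq hi]; unfold uu; exact fun h => nomatch h

lemma uu_ne_cl {i : ℕ} {j : Fin m} : uu n m i ≠ CNFVtx.cl j := by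
  unfold uu; exact fun h => nomatch h

lemma ll_ne_cl {i : ℕ} {j : Fin m} (hi : i < n) (b : Bool) : ll n m i b ≠ CNFVtx.cl j := by
  rw [ll_eq hi]; exact fun h => nomatch h

lemma ll_inj {i j : ℕ} (hi : i < n) (hj : j < n) {b b' : Bool} (h : ll n m i b = ll n m j b') : i = j ∧ b = b' := by
  rw [ll_eq hi, ll_eq hj] at h
  have := CNFVtx.lit.inj h
  exact ⟨congrArg Fin.val this.1, this.2⟩

lemma ww_zero : ww n m 0 = uu n m 0 := if_pos rfl

lemma ww_cl (j : Fin m) : ww n m (j + 1) = CNFVtx.cl j := by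
  unfold ww
  rw [if_neg (by omega), dif_pos (by simp)]
  congr 1

lemma ww_last : ww n m (m + 1) = uu n m n := by
  unfold ww
  rw [if_neg (by omega), dif_neg (by omega)]

lemma ww_cases {j : ℕ} (hj : j ≤ m + 1) : j = 0 ∨ (∃ i : Fin m, j = i + 1) ∨ j = m + 1 := by
  by_cases h0 : j = 0
  · exact Or.inl h0
  by_cases h1 : j = m + 1
  · exact Or.inr (Or.inr h1)
  exact Or.inr (Or.inl ⟨⟨j - 1, by omega⟩, by simp only; omega⟩)

lemma ww_inj (hn : 2 ≤ n) {i j : ℕ} (hi : i ≤ m + 1) (hj : j ≤ m + 1) (h : ww n m i = ww n m j) : i = j := by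
  rcases ww_cases hi with rfl | ⟨a, rfl⟩ | rfl <;> rcases ww_cases hj with rfl | ⟨b, rfl⟩ | rfl <;>
    simp only [ww_zero, ww_cl, ww_last] at h
  · rfl
  · exact absurd h uu_ne_cl
  · have := uu_inj (by omega) le_rfl h; omega
  · exact absurd h.symm uu_ne_cl
  · rw [CNFVtx.cl.inj h]
  · exact absurd h.symm uu_ne_cl
  · have := uu_inj le_rfl (by omega) h; omega
  · exact absurd h uu_ne_cl
  · rfl

lemma adj_of_rel {a b : CNFVtx n m} (h : cnfRel n m a b) (hab : a ≠ b) : (cnfGraph n m).Adj a b :=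
  (SimpleGraph.fromRel_adj _ _ _).2 ⟨hab, Or.inl h⟩

lemma adj1 {i : ℕ} (hi : i < n) (b : Bool) : (cnfGraph n m).Adj (uu n m i) (ll n m i b) :=
  adj_of_rel (Or.inl ⟨⟨i, hi⟩, b, (uu_castSucc ⟨i, hi⟩).symm, ll_eq hi b⟩) (uu_ne_ll hi b)

lemma adj2 {i : ℕ} (hi : i < n) (b : Bool) : (cnfGraph n m).Adj (ll n m i b) (uu n m (i + 1)) :=
  adj_of_rel (Or.inr (Or.inl ⟨⟨i, hi⟩, b, ll_eq hi b, (uu_succ ⟨i, hi⟩).symm⟩)) (uu_ne_ll hi b).symm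

lemma adj3 (hn : 2 ≤ n) : (cnfGraph n m).Adj (uu n m n) (uu n m 0) :=
  adj_of_rel (Or.inr (Or.inr (Or.inr (Or.inr (Or.inr ⟨uu_last.symm, uu_zero.symm⟩)))))
    (fun h => by have := uu_inj le_rfl (by omega) h; omega)

lemma adj4 (hn : 2 ≤ n) (hm : 1 ≤ m) {j : ℕ} (hj : j < m + 1) : (cnfGraph n m).Adj (ww n m j) (ww n m (j + 1)) := by
  refine adj_of_rel ?_ (fun h => by have := ww_inj hn (by omega) (by omega) h; omega)
  rcases ww_cases (m := m) (j := j) (by omega) with rfl | ⟨a, rfl⟩ | rfl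
  · refine Or.inr (Or.inr (Or.inl ⟨⟨0, hm⟩, rfl, ?_, ?_⟩))
    · rw [ww_zero, uu_zero]
    · exact ww_cl ⟨0, hm⟩
  · by_cases ha : (a : ℕ) + 1 = m
    · refine Or.inr (Or.inr (Or.inr (Or.inr (Or.inl ⟨a, ha, ww_cl a, ?_⟩))))
      rw [ha, ww_last, uu_last]
    · exact Or.inr (Or.inr (Or.inr (Or.inl ⟨a, ⟨a + 1, by omega⟩, rfl, ww_cl a, ww_cl ⟨a + 1, by omega⟩⟩)))
  · omega

lemma cycle_eq (hm : 1 ≤ m) : cycleEdges n m = wE (ww n m) (m + 1) ∪ {s(uu n m n, uu n m 0)} := by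
  unfold cycleEdges
  rw [uu_last, uu_zero]
  congr 1
  ext s
  constructor
  · rintro ((⟨j, hj, rfl⟩ | ⟨j, j', hj, rfl⟩) | ⟨j, hj, rfl⟩)
    · refine ⟨0, by omega, ?_⟩
      have := ww_cl (n := n) j
      rw [hj] at this
      rw [ww_zero, this]
    · refine ⟨j + 1, by omega, ?_⟩
      rw [← hj, ww_cl, hj, ww_cl]
    · refine ⟨j + 1, by omega, ?_⟩
      rw [ww_cl, hj, ww_last]
  · rintro ⟨j, hj, rfl⟩
    rcases ww_cases (m := m) (j := j) (by omega) with rfl | ⟨a, rfl⟩ | rfl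
    · refine Or.inl (Or.inl ⟨⟨0, hm⟩, rfl, ?_⟩)
      rw [ww_zero, ← ww_cl ⟨0, hm⟩]
    · by_cases ha : (a : ℕ) + 1 = m
      · refine Or.inr ⟨a, ha, ?_⟩
        rw [ww_cl, ha, ww_last]
      · refine Or.inl (Or.inr ⟨a, ⟨a + 1, by omega⟩, rfl, ?_⟩)
        rw [← ww_cl, ← ww_cl]
    · omega

lemma XE_ll {i : ℕ} {b : Bool} {s : Sym2 (CNFVtx n m)} (hs : s ∈ XE n m i b) : ll n m i b ∈ s := by
  rcases hs with rfl | rfl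
  · exact Sym2.mem_mk_right _ _
  · exact Sym2.mem_mk_left _ _

lemma XE_v {i : ℕ} {b : Bool} {s : Sym2 (CNFVtx n m)} (hs : s ∈ XE n m i b) {v} (hv : v ∈ s) :
    v = ll n m i b ∨ v = uu n m i ∨ v = uu n m (i + 1) := by
  rcases hs with rfl | rfl
  · rcases Sym2.mem_iff.1 hv with h | h <;> tauto
  · rcases Sym2.mem_iff.1 hv with h | h <;> tauto

lemma wE_v {s : Sym2 (CNFVtx n m)} (hs : s ∈ wE (ww n m) (m + 1)) {v} (hv : v ∈ s) :
    v = uu n m 0 ∨ v = uu n m n ∨ ∃ j, v = CNFVtx.cl j := by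
  obtain ⟨j, hj, rfl⟩ := hs
  have aux : ∀ j ≤ m + 1, ww n m j = uu n m 0 ∨ ww n m j = uu n m n ∨ ∃ i, ww n m j = CNFVtx.cl i := by
    intro j hj
    rcases ww_cases hj with rfl | ⟨a, rfl⟩ | rfl
    · exact Or.inl ww_zero
    · exact Or.inr (Or.inr ⟨a, ww_cl a⟩)
    · exact Or.inr (Or.inl ww_last)
  rcases Sym2.mem_iff.1 hv with rfl | rfl
  · exact aux _ (by omega)
  · exact aux _ (by omega)

lemma cyc_v (hm : 1 ≤ m) {s : Sym2 (CNFVtx n m)} (hs : s ∈ cycleEdges n m) {v} (hv : v ∈ s) :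
    v = uu n m 0 ∨ v = uu n m n ∨ ∃ j, v = CNFVtx.cl j := by
  rw [cycle_eq hm] at hs
  rcases hs with hs | rfl
  · exact wE_v hs hv
  · rcases Sym2.mem_iff.1 hv with h | h <;> tauto

lemma wE_cl (hm : 1 ≤ m) {s : Sym2 (CNFVtx n m)} (hs : s ∈ wE (ww n m) (m + 1)) : ∃ j, CNFVtx.cl j ∈ s := by
  obtain ⟨j, hj, rfl⟩ := hs
  rcases ww_cases (m := m) (j := j) (by omega) with rfl | ⟨a, rfl⟩ | rfl
  · exact ⟨⟨0, hm⟩, by rw [← ww_cl ⟨0, hm⟩]; exact Sym2.mem_mk_right _ _⟩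
  · exact ⟨a, by rw [← ww_cl a]; exact Sym2.mem_mk_left _ _⟩
  · omega

lemma edge_cases (hm : 1 ≤ m) {s : Sym2 (CNFVtx n m)} (hs : s ∈ (cnfGraph n m).edgeSet) :
    s ∈ cycleEdges n m ∨ ∃ i < n, ∃ b, s ∈ XE n m i b := by
  have main : ∀ a b : CNFVtx n m, cnfRel n m a b → s(a, b) ∈ cycleEdges n m ∨ ∃ i < n, ∃ c, s(a, b) ∈ XE n m i c := by
    rintro a b (⟨i, p, rfl, rfl⟩ | ⟨i, p, rfl, rfl⟩ | ⟨j, hj, rfl, rfl⟩ | ⟨j, j', hj, rfl, rfl⟩ | ⟨j, hj, rfl, rfl⟩ | ⟨rfl, rfl⟩)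
    · refine Or.inr ⟨i, i.2, p, Or.inl ?_⟩
      rw [uu_castSucc, ll_eq i.2]
    · refine Or.inr ⟨i, i.2, p, Or.inr ?_⟩
      rw [uu_succ, ll_eq i.2]; rfl
    · exact Or.inl (Or.inl (Or.inl (Or.inl ⟨j, hj, rfl⟩)))
    · exact Or.inl (Or.inl (Or.inl (Or.inr ⟨j, j', hj, rfl⟩)))
    · exact Or.inl (Or.inl (Or.inr ⟨j, hj, rfl⟩))
    · exact Or.inl (Or.inr rfl)
  induction s with
  | _ a b =>
    have h := (SimpleGraph.fromRel_adj _ _ _).1 ((SimpleGraph.mem_edgeSet _).1 hs)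
    rcases h.2 with h | h
    · exact main a b h
    · rw [Sym2.eq_swap]; exact main b a h

lemma mkConfig (hn : 2 ≤ n) (hm : 1 ≤ m) (Φ : PlaneEmbedding (cnfGraph n m)) :
    Config n (fun i => Φ.vmap (uu n m i)) (fun i b => AE Φ (XE n m i b)) (AE Φ (wE (ww n m) (m + 1)))
      (AA Φ s(uu n m n, uu n m 0)) where
  hn := hn
  inj := fun i hi j hj h => uu_inj hi hj (Φ.vmap_inj h)
  hX := fun i hi b => by
    have : AE Φ (XE n m i b) = AA Φ s(uu n m i, ll n m i b) ∪ AA Φ s(ll n m i b, uu n m (i + 1)) := by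
      rw [← AE_singleton, ← AE_singleton, ← AE_union]; rfl
    rw [this]
    refine (AA_arc (adj1 hi b)).concat (AA_arc (adj2 hi b)) ?_
    rintro x ⟨h1, h2⟩
    have hne : uu n m i ≠ uu n m (i + 1) := fun h => by
      have := uu_inj (by omega) (by omega) h; omega
    obtain ⟨v, hv, hv', rfl⟩ := AA_inter (fun h => by
      have h3 : uu n m i ∈ s(ll n m i b, uu n m (i + 1)) := h ▸ Sym2.mem_mk_left _ _
      rcases Sym2.mem_iff.1 h3 with h3 | h3
      · exact uu_ne_ll hi b h3
      · exact hne h3) h1 h2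
    rcases Sym2.mem_iff.1 hv with rfl | rfl
    · rcases Sym2.mem_iff.1 hv' with h3 | h3
      · exact absurd h3 (uu_ne_ll hi b)
      · exact absurd h3 hne
    · rfl
  hP := by
    have := walk_arc (Φ := Φ) (ww n m) m (fun i hi j hj h => ww_inj hn hi hj h) (fun j hj => adj4 hn hm hj)
    rwa [ww_zero, ww_last] at this
  he := (AA_arc (adj3 hn)).symm
  iPe := fun x hx hx' => by
    rw [← AE_singleton] at hx'
    obtain ⟨s, hs, s', rfl, v, hv, hv', rfl⟩ := AE_inter (by
      rintro s hs rfl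
      obtain ⟨j, hj⟩ := wE_cl hm hs
      rcases Sym2.mem_iff.1 hj with h | h <;> exact uu_ne_cl h.symm) hx hx'
    rcases Sym2.mem_iff.1 hv' with rfl | rfl
    · exact ⟨n, le_rfl, rfl⟩
    · exact ⟨0, by omega, rfl⟩
  iX := fun i hi j hj b b' hne x hx hx' => by
    have hl : ll n m i b ≠ ll n m j b' := fun h => by
      have := ll_inj hi hj h; tauto
    obtain ⟨s, hs, s', hs', v, hv, hv', rfl⟩ := AE_inter (by
      intro s hs hs'
      rcases XE_v hs' (XE_ll hs) with h | h | h
      · exact hl h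
      · exact uu_ne_ll hi b h.symm
      · exact uu_ne_ll hi b h.symm) hx hx'
    rcases XE_v hs hv with rfl | rfl | rfl
    · rcases XE_v hs' hv' with h | h | h
      · exact absurd h hl
      · exact absurd h.symm (uu_ne_ll hi b)
      · exact absurd h.symm (uu_ne_ll hi b)
    · exact ⟨i, by omega, rfl⟩
    · exact ⟨i + 1, by omega, rfl⟩
  uX := fun i hi j hj b h => by
    obtain ⟨s, hs, hv⟩ := AE_v h
    rcases XE_v hs hv with h | h | h
    · exact absurd h (uu_ne_ll hi b)
    · exact Or.inl (uu_inj hj (by omega) h)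
    · exact Or.inr (uu_inj hj (by omega) h)
  iXC := fun i hi b x hx hx' => by
    rw [← AE_singleton, ← AE_union, ← cycle_eq hm] at hx'
    have key : ∀ v : CNFVtx n m, v = ll n m i b → ∀ s ∈ cycleEdges n m, v ∉ s := by
      rintro v rfl s hs hv
      rcases cyc_v hm hs hv with h | h | ⟨j, h⟩
      · exact uu_ne_ll hi b h.symm
      · exact uu_ne_ll hi b h.symm
      · exact ll_ne_cl hi b h
    obtain ⟨s, hs, s', hs', v, hv, hv', rfl⟩ := AE_inter (fun s hs hs' => key _ rfl s hs' (XE_ll hs)) hx hx'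
    rcases XE_v hs hv with h | rfl | rfl
    · exact absurd hv' (key v h s' hs')
    · exact ⟨i, by omega, rfl⟩
    · exact ⟨i + 1, by omega, rfl⟩
  uC := fun k hk h => by
    rw [← AE_singleton, ← AE_union, ← cycle_eq hm] at h
    obtain ⟨s, hs, hv⟩ := AE_v h
    rcases cyc_v hm hs hv with h | h | ⟨j, h⟩
    · exact Or.inl (uu_inj hk (by omega) h)
    · exact Or.inr (uu_inj hk le_rfl h)
    · exact absurd h uu_ne_cl

lemma drawing_eq (hm : 1 ≤ m) (Φ : PlaneEmbedding (cnfGraph n m)) :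
    Φ.drawing = AE Φ (wE (ww n m) (m + 1)) ∪ AA Φ s(uu n m n, uu n m 0) ∪
      {x | ∃ j < n, ∃ b, x ∈ AE Φ (XE n m j b)} := by
  rw [← AE_singleton, ← AE_union, ← cycle_eq hm]
  ext x
  constructor
  · intro hx
    obtain ⟨⟨s, hs⟩, hx⟩ := mem_iUnion.1 hx
    rcases edge_cases hm hs with h | ⟨i, hi, b, h⟩
    · exact Or.inl ⟨s, h, hs, hx⟩
    · exact Or.inr ⟨i, hi, b, s, h, hs, hx⟩
  · rintro (⟨s, -, hs, hx⟩ | ⟨i, hi, b, s, -, hs, hx⟩)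
    · exact mem_iUnion.2 ⟨⟨s, hs⟩, hx⟩
    · exact mem_iUnion.2 ⟨⟨s, hs⟩, hx⟩

end cnf
end Pl

/-- in every plane embedding `Φ` of `G_φ` (with `n ≥ 2`, `m ≥ 1`):
(1) the cycle `c_1, …, c_m, u_n, u_0` forms the boundary of some face `F` (the frontier of `F`
is exactly the union of the arcs of its edges); (2) there is exactly one face `F' ≠ F` whose
boundary contains all of `c_1, …, c_m`; and (3) for each `i`, exactly one of the two vertices
`x_i` and `x̄_i` lies on the boundary of `F'`. -/
theorem statement2 (n m : ℕ) (hn : 2 ≤ n) (hm : 1 ≤ m)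
    (Φ : PlaneEmbedding (cnfGraph n m)) :
    ∃ F : Set (ℝ × ℝ), Φ.IsFace F ∧
      (frontier F =
        ⋃ (e : (cnfGraph n m).edgeSet) (_ : (e : Sym2 (CNFVtx n m)) ∈ cycleEdges n m),
          Φ.arc e) ∧
      (∃! F' : Set (ℝ × ℝ),
        Φ.IsFace F' ∧ F' ≠ F ∧ ∀ j : Fin m, Φ.OnFace F' (CNFVtx.cl j)) ∧
      (∀ F' : Set (ℝ × ℝ), Φ.IsFace F' → F' ≠ F →
        (∀ j : Fin m, Φ.OnFace F' (CNFVtx.cl j)) →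
        ∀ i : Fin n,
          Xor' (Φ.OnFace F' (CNFVtx.lit i true)) (Φ.OnFace F' (CNFVtx.lit i false))) := by
  obtain ⟨p, hp, hpf, ⟨q, hq, hpq, hPq⟩, huniq, hxor⟩ :=
    Pl.config_main (Pl.mkConfig hn hm Φ) (Pl.drawing_eq hm Φ)
  have hcl : ∀ j : Fin m, Φ.vmap (CNFVtx.cl j) ∈ Pl.AE Φ (Pl.wE (Pl.ww n m) (m + 1)) \
      {Φ.vmap (Pl.uu n m 0), Φ.vmap (Pl.uu n m n)} := by
    intro j
    refine ⟨⟨s(Pl.ww n m j, Pl.ww n m (j + 1)), ⟨j, by omega, rfl⟩, ?_⟩, ?_⟩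
    · rw [← Pl.ww_cl j]
      exact (Pl.AA_arc (Pl.adj4 hn hm (by omega))).right_mem
    · rintro (h | h)
      · exact Pl.uu_ne_cl (Φ.vmap_inj h).symm
      · exact Pl.uu_ne_cl (Φ.vmap_inj h).symm
  have hlit : ∀ (i : Fin n) (b : Bool), Φ.vmap (CNFVtx.lit i b) ∈ Pl.AE Φ (Pl.XE n m i b) \
      {Φ.vmap (Pl.uu n m i), Φ.vmap (Pl.uu n m (i + 1))} := by
    intro i b
    have he : (CNFVtx.lit i b : CNFVtx n m) = Pl.ll n m i b := (Pl.ll_eq i.2 b).symm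
    rw [he]
    refine ⟨⟨_, Or.inl rfl, (Pl.AA_arc (Pl.adj1 i.2 b)).right_mem⟩, ?_⟩
    rintro (h | h)
    · exact Pl.uu_ne_ll i.2 b (Φ.vmap_inj h).symm
    · exact Pl.uu_ne_ll i.2 b (Φ.vmap_inj h).symm
  have hne : ∀ q, connectedComponentIn Φ.drawingᶜ q ≠ connectedComponentIn Φ.drawingᶜ p →
      ¬ Pl.Same Φ.drawing p q := fun q h h' => h h'.eq.symm
  refine ⟨connectedComponentIn Φ.drawingᶜ p, ⟨p, hp, rfl⟩, ?_, ?_, ?_⟩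
  · rw [hpf, ← Pl.AE_singleton, ← Pl.AE_union, ← Pl.cycle_eq hm]
    ext x
    simp only [mem_iUnion]
    constructor
    · rintro ⟨s, hs, h, hx⟩
      exact ⟨⟨s, h⟩, hs, hx⟩
    · rintro ⟨⟨s, h⟩, hs, hx⟩
      exact ⟨s, hs, h, hx⟩
  · refine ⟨connectedComponentIn Φ.drawingᶜ q, ⟨⟨q, hq, rfl⟩, ?_, fun j => hPq (hcl j).1⟩, ?_⟩
    · intro h
      apply hpq
      rw [Pl.Same, ← h]
      exact mem_connectedComponentIn hq
    · rintro _ ⟨⟨q', hq', rfl⟩, h1, h2⟩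
      exact (huniq q' q _ _ hq' hq (hne q' h1) hpq (hcl ⟨0, hm⟩) (hcl ⟨0, hm⟩) (h2 ⟨0, hm⟩) (hPq (hcl ⟨0, hm⟩).1)).eq
  · rintro _ ⟨q', hq', rfl⟩ h1 h2 i
    exact hxor q' _ hq' (hne q' h1) (hcl ⟨0, hm⟩) (h2 ⟨0, hm⟩) i i.2 _ (hlit i true) _ (hlit i false)
end

section
/- Let φ be a CNF formula over variables x₁,…,x_n with n ≥ 2 and clauses C₁,…,C_m with m ≥ 1. For every set S ⊆ {x₁,…,x_n} ∪ {x̄₁,…,x̄_n} with |S ∩ {x_i, x̄_i}| = 1 for all i ∈ {1,…,n}, the graph G_φ has a plane embedding in which the boundary of a single face contains all of the vertices c₁,…,c_m and all of the vertices in S. -/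
open Set Topology

/-- Index type for the edges of `G_φ`. -/
inductive CNFEdge (n m : ℕ) : Type where
  | top : Fin (m + 1) → CNFEdge n m
  | half : Fin n → Bool → Bool → CNFEdge n m
  | bot : CNFEdge n m

/-- The vertices of the path `u_0, c_1, …, c_m, u_n`. -/
def pathVtx (n m : ℕ) (k : ℕ) : CNFVtx n m :=
  if k = 0 then CNFVtx.u 0 else
    if h : k - 1 < m then CNFVtx.cl ⟨k - 1, h⟩ else CNFVtx.u (Fin.last n)

namespace CNFEdge

variable {n m : ℕ}

def lft : CNFEdge n m → CNFVtx n m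
  | top k => pathVtx n m k
  | half i _ false => CNFVtx.u i.castSucc
  | half i p true => CNFVtx.lit i p
  | bot => CNFVtx.u 0

def rgt : CNFEdge n m → CNFVtx n m
  | top k => pathVtx n m (k + 1)
  | half i p false => CNFVtx.lit i p
  | half i _ true => CNFVtx.u i.succ
  | bot => CNFVtx.u (Fin.last n)

/-- left `x`-coordinate -/
noncomputable def lo : CNFEdge n m → ℝ
  | top k => 2 * n * k / (m + 1)
  | half i _ false => 2 * i
  | half i _ true => 2 * i + 1
  | bot => 0

/-- right `x`-coordinate -/
noncomputable def hi : CNFEdge n m → ℝ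
  | top k => 2 * n * (k + 1) / (m + 1)
  | half i _ false => 2 * i + 1
  | half i _ true => 2 * i + 2
  | bot => 2 * n

/-- function whose graph is the arc -/
noncomputable def fn (s : Fin n → Bool) : CNFEdge n m → ℝ → ℝ
  | top _, x => x * (2 * n - x)
  | half i p _, x => if p = s i then 0 else - ((x - 2 * i) * (2 * i + 2 - x))
  | bot, x => - 2 * (x * (2 * n - x))

end CNFEdge

/-- vertex positions -/
noncomputable def pos {n m : ℕ} (s : Fin n → Bool) : CNFVtx n m → ℝ × ℝ
  | CNFVtx.lit i p => (2 * i + 1, if p = s i then 0 else -1)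
  | CNFVtx.cl j => (2 * n * (j + 1) / (m + 1),
      (2 * n * (j + 1) / (m + 1)) * (2 * n - 2 * n * (j + 1) / (m + 1)))
  | CNFVtx.u i => (2 * i, 0)

/-- the arc of an edge -/
def grArc {n m : ℕ} (s : Fin n → Bool) (k : CNFEdge n m) : Set (ℝ × ℝ) :=
  {p | k.lo ≤ p.1 ∧ p.1 ≤ k.hi ∧ p.2 = k.fn s p.1}

lemma cnf_edge_exists {n m : ℕ} (e : (cnfGraph n m).edgeSet) :
    ∃ k : CNFEdge n m, (e : Sym2 (CNFVtx n m)) = s(k.lft, k.rgt) := by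
  obtain ⟨e, he⟩ := e
  induction e using Sym2.ind with
  | _ a b =>
  have key : ∀ a b : CNFVtx n m, cnfRel n m a b → ∃ k : CNFEdge n m, s(a, b) = s(k.lft, k.rgt) := by
    intro a b h
    rcases h with ⟨i, p, rfl, rfl⟩ | ⟨i, p, rfl, rfl⟩ | ⟨j, hj, rfl, rfl⟩ | ⟨j, j', hj, rfl, rfl⟩ |
      ⟨j, hj, rfl, rfl⟩ | ⟨rfl, rfl⟩
    · exact ⟨.half i p false, rfl⟩
    · exact ⟨.half i p true, rfl⟩
    · refine ⟨.top 0, ?_⟩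
      obtain ⟨j, hjm⟩ := j
      simp only at hj
      subst hj
      simp [CNFEdge.lft, CNFEdge.rgt, pathVtx, hjm]
    · refine ⟨.top ⟨j', by omega⟩, ?_⟩
      obtain ⟨j, hjm⟩ := j
      obtain ⟨j', hjm'⟩ := j'
      simp only at hj
      subst hj
      simp [CNFEdge.lft, CNFEdge.rgt, pathVtx, hjm, hjm']
    · refine ⟨.top ⟨m, by omega⟩, ?_⟩
      obtain ⟨j, hjm⟩ := j
      simp only at hj
      subst hj
      simp [CNFEdge.lft, CNFEdge.rgt, pathVtx]
    · exact ⟨.bot, Sym2.eq_swap⟩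
  simp only [cnfGraph, SimpleGraph.mem_edgeSet, SimpleGraph.fromRel_adj] at he
  rcases he with ⟨_, h | h⟩
  · exact key a b h
  · obtain ⟨k, hk⟩ := key b a h
    exact ⟨k, Sym2.eq_swap.trans hk⟩

lemma pos_pathVtx {n m : ℕ} (s : Fin n → Bool) (k : ℕ) (hk : k ≤ m + 1) :
    pos s (pathVtx n m k) = (2 * n * (k : ℝ) / (m + 1),
      (2 * n * (k : ℝ) / (m + 1)) * (2 * n - 2 * n * (k : ℝ) / (m + 1))) := by
  unfold pathVtx
  split_ifs with h0 h1
  · subst h0; simp [pos]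
  · obtain ⟨k, rfl⟩ : ∃ k', k = k' + 1 := ⟨k - 1, by omega⟩
    simp [pos]
  · have : k = m + 1 := by omega
    subst this
    have : (m : ℝ) + 1 ≠ 0 := by positivity
    have h : 2 * (n : ℝ) * (m + 1) / (m + 1) = 2 * n := by field_simp
    simp [pos, h]

lemma pos_lft {n m : ℕ} (s : Fin n → Bool) (k : CNFEdge n m) :
    pos s k.lft = (k.lo, k.fn s k.lo) := by
  rcases k with k | ⟨i, p, _ | _⟩ | _
  · exact pos_pathVtx s k (by omega)
  · simp [CNFEdge.lft, CNFEdge.lo, CNFEdge.fn, pos]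
  · simp only [CNFEdge.lft, CNFEdge.lo, CNFEdge.fn, pos]
    congr 2; ring
  · simp [CNFEdge.lft, CNFEdge.lo, CNFEdge.fn, pos]

lemma pos_rgt {n m : ℕ} (s : Fin n → Bool) (k : CNFEdge n m) :
    pos s k.rgt = (k.hi, k.fn s k.hi) := by
  rcases k with k | ⟨i, p, _ | _⟩ | _
  · have := pos_pathVtx (m := m) s (k + 1) (by omega)
    simpa [CNFEdge.rgt, CNFEdge.hi, CNFEdge.fn] using this
  · simp only [CNFEdge.rgt, CNFEdge.hi, CNFEdge.fn, pos]
    congr 2; ring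
  · simp [CNFEdge.rgt, CNFEdge.hi, CNFEdge.fn, pos]; ring
  · simp [CNFEdge.rgt, CNFEdge.hi, CNFEdge.fn, pos]

lemma lo_lt_hi {n m : ℕ} (hn : 2 ≤ n) (k : CNFEdge n m) : k.lo < k.hi := by
  have : (0 : ℝ) < n := by exact_mod_cast (by omega : 0 < n)
  rcases k with k | ⟨i, p, _ | _⟩ | _ <;> simp only [CNFEdge.lo, CNFEdge.hi]
  · gcongr; linarith
  · linarith
  · linarith
  · linarith

lemma fn_cont {n m : ℕ} (s : Fin n → Bool) (k : CNFEdge n m) : Continuous (k.fn s) := by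
  rcases k with k | ⟨i, p, q⟩ | _
  · change Continuous fun x : ℝ => x * (2 * n - x); fun_prop
  · by_cases h : p = s i
    · have : (CNFEdge.half i p q : CNFEdge n m).fn s = fun _ => 0 := by
        ext x; simp [CNFEdge.fn, h]
      rw [this]; fun_prop
    · have : (CNFEdge.half i p q : CNFEdge n m).fn s =
          fun x : ℝ => - ((x - 2 * (i : ℝ)) * (2 * i + 2 - x)) := by
        ext x; simp [CNFEdge.fn, h]
      rw [this]; fun_prop
  · change Continuous fun x : ℝ => - 2 * (x * (2 * n - x)); fun_prop

lemma fn_nonneg {n : ℕ} (x : ℝ) (h0 : 0 ≤ x) (h1 : x ≤ 2 * n) : 0 ≤ x * (2 * n - x) :=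
  mul_nonneg h0 (by linarith)

lemma half_bounds {n m : ℕ} {i : Fin n} {p q : Bool} {x : ℝ}
    (h1 : (CNFEdge.half i p q : CNFEdge n m).lo ≤ x)
    (h2 : x ≤ (CNFEdge.half i p q : CNFEdge n m).hi) : 2 * (i : ℝ) ≤ x ∧ x ≤ 2 * i + 2 := by
  cases q <;> simp only [CNFEdge.lo, CNFEdge.hi] at h1 h2 <;> constructor <;> linarith

lemma half_nonpos {n m : ℕ} (s : Fin n → Bool) {i : Fin n} {p q : Bool} {x : ℝ}
    (h1 : 2 * (i : ℝ) ≤ x) (h2 : x ≤ 2 * i + 2) :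
    (CNFEdge.half i p q : CNFEdge n m).fn s x ≤ 0 := by
  simp only [CNFEdge.fn]
  split_ifs
  · exact le_rfl
  · nlinarith [mul_nonneg (sub_nonneg.2 h1) (sub_nonneg.2 h2)]

lemma top_bounds {n m : ℕ} {k : Fin (m + 1)} {x : ℝ}
    (h1 : (CNFEdge.top k : CNFEdge n m).lo ≤ x)
    (h2 : x ≤ (CNFEdge.top k : CNFEdge n m).hi) : 0 ≤ x ∧ x ≤ 2 * n := by
  simp only [CNFEdge.lo, CNFEdge.hi] at h1 h2
  have hk : (k : ℝ) + 1 ≤ m + 1 := by exact_mod_cast k.2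
  refine ⟨le_trans (by positivity) h1, h2.trans ?_⟩
  rw [div_le_iff₀ (by positivity)]
  gcongr

lemma fin_real_lt {n : ℕ} (i : Fin n) : (i : ℝ) + 1 ≤ n := by exact_mod_cast i.2

lemma cl_bounds {n m : ℕ} (hn : 2 ≤ n) (j : Fin m) :
    0 < 2 * (n : ℝ) * (j + 1) / (m + 1) ∧ 2 * (n : ℝ) * (j + 1) / (m + 1) < 2 * n := by
  have : (0 : ℝ) < n := by exact_mod_cast (by omega : 0 < n)
  have hk := fin_real_lt j
  refine ⟨by positivity, ?_⟩
  rw [div_lt_iff₀ (by positivity)]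
  gcongr
  exact j.2

lemma pos_cl_pos {n m : ℕ} (hn : 2 ≤ n) (s : Fin n → Bool) (j : Fin m) :
    0 < (pos s (CNFVtx.cl j : CNFVtx n m)).2 := by
  obtain ⟨h1, h2⟩ := cl_bounds hn j
  exact mul_pos h1 (by linarith)

lemma X_le {n m : ℕ} (hn : 2 ≤ n) {a b : ℕ}
    (h : 2 * (n : ℝ) * (a : ℝ) / (m + 1) ≤ 2 * (n : ℝ) * (b : ℝ) / (m + 1)) : a ≤ b := by
  have h0 : (0 : ℝ) < n := by exact_mod_cast (by omega : 0 < n)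
  have h1 : (0 : ℝ) < m + 1 := by positivity
  rw [div_le_div_iff_of_pos_right h1] at h
  have := le_of_mul_le_mul_left h (by positivity)
  exact_mod_cast this

lemma h_zero {n : ℕ} {x : ℝ} (h : x * (2 * n - x) = 0) : x = 0 ∨ x = 2 * n := by
  rcases mul_eq_zero.1 h with h | h
  · left; exact h
  · right; linarith

lemma pos_inj {n m : ℕ} (hn : 2 ≤ n) (s : Fin n → Bool) :
    Function.Injective (pos s : CNFVtx n m → ℝ × ℝ) := by
  have lc : ∀ i p j, pos s (CNFVtx.lit i p : CNFVtx n m) ≠ pos s (CNFVtx.cl j : CNFVtx n m) := by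
    intro i p j h
    have h1 := pos_cl_pos hn s j
    rw [← h] at h1
    simp only [pos] at h1
    split_ifs at h1 <;> linarith
  have lu : ∀ i p j, pos s (CNFVtx.lit i p : CNFVtx n m) ≠ pos s (CNFVtx.u j : CNFVtx n m) := by
    intro i p j h
    have h1 := congrArg Prod.fst h
    simp only [pos] at h1
    have : 2 * (i : ℕ) + 1 = 2 * (j : ℕ) := by exact_mod_cast h1
    omega
  have uc : ∀ i j, pos s (CNFVtx.u i : CNFVtx n m) ≠ pos s (CNFVtx.cl j : CNFVtx n m) := by
    intro i j h
    have h1 := pos_cl_pos hn s j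
    rw [← h] at h1
    simp [pos] at h1
  rintro (⟨i, p⟩ | j | i) (⟨i', p'⟩ | j' | i') h
  · have h1 := congrArg Prod.fst h
    have h2 := congrArg Prod.snd h
    simp only [pos] at h1 h2
    have : 2 * (i : ℕ) + 1 = 2 * (i' : ℕ) + 1 := by exact_mod_cast h1
    obtain rfl : i = i' := by ext; omega
    congr 1
    revert h2
    generalize s i = t
    cases p <;> cases p' <;> cases t <;> simp
  · exact absurd h (lc _ _ _)
  · exact absurd h (lu _ _ _)
  · exact absurd h.symm (lc _ _ _)
  · have h1 := congrArg Prod.fst h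
    simp only [pos] at h1
    have a1 := X_le (n := n) (m := m) (a := j + 1) (b := j' + 1) hn (by push_cast; exact h1.le)
    have a2 := X_le (n := n) (m := m) (a := j' + 1) (b := j + 1) hn (by push_cast; exact h1.ge)
    congr 1; ext; omega
  · exact absurd h.symm (uc _ _)
  · exact absurd h.symm (lu _ _ _)
  · exact absurd h (uc _ _)
  · have h1 := congrArg Prod.fst h
    simp only [pos] at h1
    have : 2 * (i : ℕ) = 2 * (i' : ℕ) := by exact_mod_cast h1
    congr 1; ext; omega

lemma lft_mem {n m : ℕ} (hn : 2 ≤ n) (s : Fin n → Bool) (k : CNFEdge n m) (v : CNFVtx n m)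
    (h : pos s v ∈ grArc s k) (h' : (pos s v).1 ≤ k.lo ∨ k.hi ≤ (pos s v).1) :
    v ∈ s(k.lft, k.rgt) := by
  obtain ⟨h1, h2, h3⟩ := h
  rw [Sym2.mem_iff]
  rcases h' with h' | h'
  · left
    apply pos_inj hn s
    rw [pos_lft]
    have := le_antisymm h' h1
    ext
    · exact this
    · rw [h3, this]
  · right
    apply pos_inj hn s
    rw [pos_rgt]
    have := le_antisymm h2 h'
    ext
    · exact this
    · rw [h3, this]

lemma lit_h {n m : ℕ} (s : Fin n → Bool) (i : Fin n) (p : Bool) :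
    -1 ≤ (pos s (CNFVtx.lit i p : CNFVtx n m)).2 ∧ (pos s (CNFVtx.lit i p : CNFVtx n m)).2 ≤ 0 ∧
    1 ≤ (2 * (i : ℝ) + 1) * (2 * n - (2 * i + 1)) := by
  refine ⟨?_, ?_, ?_⟩
  · simp only [pos]; split_ifs <;> norm_num
  · simp only [pos]; split_ifs <;> norm_num
  · have := fin_real_lt i
    have h0 : (0 : ℝ) ≤ i := by positivity
    nlinarith

lemma top_end {n m : ℕ} (hn : 2 ≤ n) {k : Fin (m + 1)} {x : ℝ}
    (h : (x = 0 ∨ x = 2 * n)) :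
    x ≤ (CNFEdge.top k : CNFEdge n m).lo ∨ (CNFEdge.top k : CNFEdge n m).hi ≤ x := by
  rcases h with rfl | rfl
  · left; simp only [CNFEdge.lo]; positivity
  · right; exact (top_bounds (lo_lt_hi hn _).le le_rfl).2

lemma pos_mem_arc {n m : ℕ} (hn : 2 ≤ n) (s : Fin n → Bool) (k : CNFEdge n m) (v : CNFVtx n m)
    (h : pos s v ∈ grArc s k) : v ∈ s(k.lft, k.rgt) := by
  obtain ⟨h1, h2, h3⟩ := id h
  rcases k with k | ⟨i, p, q⟩ | _
  · rcases v with ⟨i', p'⟩ | j | i'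
    · have := lit_h (m := m) s i' p'
      simp only [CNFEdge.fn] at h3
      have e : (pos s (CNFVtx.lit i' p' : CNFVtx n m)).1 = 2 * i' + 1 := rfl
      rw [e] at h3
      linarith
    · apply lft_mem hn s _ _ h
      rcases le_or_gt ((j : ℕ) + 1) k with hj | hj
      · left
        simp only [pos, CNFEdge.lo]
        gcongr
        exact_mod_cast hj
      · right
        simp only [pos, CNFEdge.hi]
        gcongr
        exact Nat.lt_succ_iff.1 hj
    · apply lft_mem hn s _ _ h
      apply top_end hn
      exact h_zero h3.symm
  · obtain ⟨b1, b2⟩ := half_bounds h1 h2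
    have hh := half_nonpos (m := m) s (p := p) (q := q) b1 b2
    rcases v with ⟨i', p'⟩ | j | i'
    · simp only [pos] at b1 b2
      have c1 : 2 * (i : ℕ) ≤ 2 * (i' : ℕ) + 1 := by exact_mod_cast b1
      have c2 : 2 * (i' : ℕ) + 1 ≤ 2 * (i : ℕ) + 2 := by exact_mod_cast b2
      obtain rfl : i' = i := by ext; omega
      simp only [pos, CNFEdge.fn] at h3
      have e : p' = p := by
        revert h3
        generalize s i' = t
        cases p <;> cases p' <;> cases t <;> simp <;> ring_nf <;> norm_num
      subst e
      cases q <;> simp [CNFEdge.lft, CNFEdge.rgt]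
    · have := pos_cl_pos hn s j
      linarith
    · apply lft_mem hn s _ _ h
      simp only [pos] at b1 b2
      have c1 : 2 * (i : ℕ) ≤ 2 * (i' : ℕ) := by exact_mod_cast b1
      have c2 : 2 * (i' : ℕ) ≤ 2 * (i : ℕ) + 2 := by exact_mod_cast b2
      have c3 : (i' : ℕ) = i ∨ (i' : ℕ) = i + 1 := by omega
      cases q <;> simp only [CNFEdge.lo, CNFEdge.hi, pos] at h1 h2 ⊢ <;> rcases c3 with c3 | c3 <;>
        rw [c3] at h1 h2 ⊢ <;> push_cast at h1 h2 ⊢ <;> first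
        | (left; linarith)
        | (right; linarith)
        | (exfalso; linarith)
  · rcases v with ⟨i', p'⟩ | j | i'
    · have := lit_h (m := m) s i' p'
      simp only [CNFEdge.fn] at h3
      have e : (pos s (CNFVtx.lit i' p' : CNFVtx n m)).1 = 2 * i' + 1 := rfl
      rw [e] at h3
      linarith
    · have := pos_cl_pos hn s j
      have h4 := fn_nonneg _ h1 h2
      simp only [CNFEdge.fn] at h3
      linarith
    · apply lft_mem hn s _ _ h
      have : (pos s (CNFVtx.u i' : CNFVtx n m)).1 * (2 * n - (pos s (CNFVtx.u i' : CNFVtx n m)).1) = 0 := by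
        simp only [CNFEdge.fn] at h3
        have e : (pos s (CNFVtx.u i' : CNFVtx n m)).2 = 0 := rfl
        linarith
      rcases h_zero this with h | h
      · left; exact h.le
      · right; exact h.ge

/-- an endpoint of an arc is a vertex -/
lemma end_vtx {n m : ℕ} (s : Fin n → Bool) {k : CNFEdge n m} {x : ℝ × ℝ}
    (h : x ∈ grArc s k) (h' : x.1 ≤ k.lo ∨ k.hi ≤ x.1) : ∃ v : CNFVtx n m, pos s v = x := by
  obtain ⟨h1, h2, h3⟩ := h
  rcases h' with h' | h'
  · have := le_antisymm h' h1
    exact ⟨k.lft, by rw [pos_lft, ← this, ← h3]⟩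
  · have := le_antisymm h2 h'
    exact ⟨k.rgt, by rw [pos_rgt, ← this, ← h3]⟩

lemma half_below {n m : ℕ} (s : Fin n → Bool) {i : Fin n} {p q : Bool} {x : ℝ}
    (h1 : 2 * (i : ℝ) ≤ x) (h2 : x ≤ 2 * i + 2) :
    - (x * (2 * n - x)) ≤ (CNFEdge.half i p q : CNFEdge n m).fn s x := by
  have := fin_real_lt i
  have h0 : (0 : ℝ) ≤ i := by positivity
  simp only [CNFEdge.fn]
  split_ifs
  · nlinarith [fn_nonneg (n := n) x (by linarith) (by linarith)]
  · have : (x - 2 * i) * (2 * i + 2 - x) ≤ x * (2 * n - x) := by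
      apply mul_le_mul <;> linarith
    linarith

lemma half_half {n m : ℕ} (s : Fin n → Bool) {i i' : Fin n} {p p' q q' : Bool} {x : ℝ × ℝ}
    (hlt : (i : ℕ) < i') (h1 : x ∈ grArc s (CNFEdge.half i p q : CNFEdge n m))
    (h2 : x ∈ grArc s (CNFEdge.half i' p' q' : CNFEdge n m)) :
    ∃ v : CNFVtx n m, pos s v = x := by
  obtain ⟨a1, a2⟩ := half_bounds h1.1 h1.2.1
  obtain ⟨b1, b2⟩ := half_bounds h2.1 h2.2.1
  apply end_vtx s h1
  right
  have : (i : ℝ) + 1 ≤ i' := by exact_mod_cast hlt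
  cases q <;> simp only [CNFEdge.hi] <;> linarith

lemma top_top {n m : ℕ} (s : Fin n → Bool) {k k' : Fin (m + 1)} {x : ℝ × ℝ}
    (hlt : (k : ℕ) < k') (h1 : x ∈ grArc s (CNFEdge.top k : CNFEdge n m))
    (h2 : x ∈ grArc s (CNFEdge.top k' : CNFEdge n m)) :
    ∃ v : CNFVtx n m, pos s v = x := by
  apply end_vtx s h1
  right
  refine le_trans ?_ h2.1
  simp only [CNFEdge.lo, CNFEdge.hi]
  gcongr
  exact_mod_cast hlt

lemma zero_vtx {n m : ℕ} (s : Fin n → Bool) {x : ℝ × ℝ} (h : x.1 * (2 * n - x.1) = 0)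
    (h2 : x.2 = 0) : ∃ v : CNFVtx n m, pos s v = x := by
  rcases h_zero h with h | h
  · exact ⟨CNFVtx.u 0, by ext <;> simp [pos, h, h2]⟩
  · exact ⟨CNFVtx.u (Fin.last n), by ext <;> simp [pos, h, h2]⟩

lemma top_half {n m : ℕ} (s : Fin n → Bool) {k : Fin (m + 1)} {i : Fin n} {p q : Bool} {x : ℝ × ℝ}
    (h1 : x ∈ grArc s (CNFEdge.top k : CNFEdge n m))
    (h2 : x ∈ grArc s (CNFEdge.half i p q : CNFEdge n m)) :
    ∃ v : CNFVtx n m, pos s v = x := by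
  obtain ⟨a1, a2⟩ := top_bounds h1.1 h1.2.1
  obtain ⟨b1, b2⟩ := half_bounds h2.1 h2.2.1
  have c1 := fn_nonneg _ a1 a2
  have c2 := half_nonpos (m := m) s (p := p) (q := q) b1 b2
  have c3 := h1.2.2
  have c4 := h2.2.2
  simp only [CNFEdge.fn] at c3
  apply zero_vtx s <;> linarith

lemma top_bot {n m : ℕ} (s : Fin n → Bool) {k : Fin (m + 1)} {x : ℝ × ℝ}
    (h1 : x ∈ grArc s (CNFEdge.top k : CNFEdge n m))
    (h2 : x ∈ grArc s (CNFEdge.bot : CNFEdge n m)) :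
    ∃ v : CNFVtx n m, pos s v = x := by
  have c3 := h1.2.2
  have c4 := h2.2.2
  simp only [CNFEdge.fn] at c3 c4
  apply zero_vtx s <;> linarith

lemma half_bot {n m : ℕ} (s : Fin n → Bool) {i : Fin n} {p q : Bool} {x : ℝ × ℝ}
    (h1 : x ∈ grArc s (CNFEdge.half i p q : CNFEdge n m))
    (h2 : x ∈ grArc s (CNFEdge.bot : CNFEdge n m)) :
    ∃ v : CNFVtx n m, pos s v = x := by
  obtain ⟨b1, b2⟩ := half_bounds h1.1 h1.2.1
  have c1 := fn_nonneg _ h2.1 h2.2.1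
  have c2 := half_below (m := m) s (p := p) (q := q) b1 b2
  have c3 := h1.2.2
  have c4 := h2.2.2
  simp only [CNFEdge.fn] at c4
  apply zero_vtx s <;> linarith

lemma half_same {n m : ℕ} (s : Fin n → Bool) {i : Fin n} {p p' q q' : Bool} {x : ℝ × ℝ}
    (hne : ¬ (p = p' ∧ q = q')) (h1 : x ∈ grArc s (CNFEdge.half i p q : CNFEdge n m))
    (h2 : x ∈ grArc s (CNFEdge.half i p' q' : CNFEdge n m)) :
    ∃ v : CNFVtx n m, pos s v = x := by
  apply end_vtx s h1
  by_cases hq : q = q'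
  · have hp : p ≠ p' := fun h => hne ⟨h, hq⟩
    have c3 := h1.2.2
    have c4 := h2.2.2
    have c5 : (x.1 - 2 * i) * (2 * i + 2 - x.1) = 0 := by
      simp only [CNFEdge.fn] at c3 c4
      revert c3 c4 hp
      generalize s i = t
      cases p <;> cases p' <;> cases t <;> simp <;> intros <;> simp_all
    rcases mul_eq_zero.1 c5 with h | h
    · left
      cases q <;> simp only [CNFEdge.lo] <;> linarith
    · right
      cases q <;> simp only [CNFEdge.hi] <;> linarith
  · obtain ⟨a1, a2, -⟩ := h1
    obtain ⟨b1, b2, -⟩ := h2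
    cases q <;> cases q' <;> simp only [CNFEdge.lo, CNFEdge.hi] at a1 a2 b1 b2 ⊢ <;> first
      | (exact absurd rfl hq)
      | (left; linarith)
      | (right; linarith)

lemma arc_vtx {n m : ℕ} (s : Fin n → Bool) {k k' : CNFEdge n m} (hne : k ≠ k') {x : ℝ × ℝ}
    (h1 : x ∈ grArc s k) (h2 : x ∈ grArc s k') : ∃ v : CNFVtx n m, pos s v = x := by
  rcases k with k | ⟨i, p, q⟩ | _ <;> rcases k' with k' | ⟨i', p', q'⟩ | _
  · have : (k : ℕ) ≠ k' := fun h => hne (by rw [Fin.ext h])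
    rcases lt_or_gt_of_ne this with h | h
    · exact top_top s h h1 h2
    · exact top_top s h h2 h1
  · exact top_half s h1 h2
  · exact top_bot s h1 h2
  · exact top_half s h2 h1
  · by_cases hi : i = i'
    · subst hi
      refine half_same s ?_ h1 h2
      rintro ⟨rfl, rfl⟩
      exact hne rfl
    · have : (i : ℕ) ≠ i' := fun h => hi (Fin.ext h)
      rcases lt_or_gt_of_ne this with h | h
      · exact half_half s h h1 h2
      · exact half_half s h h2 h1
  · exact half_bot s h1 h2
  · exact top_bot s h2 h1
  · exact half_bot s h2 h1
  · exact absurd rfl hne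

lemma grArc_path {n m : ℕ} (hn : 2 ≤ n) (s : Fin n → Bool) (k : CNFEdge n m) :
    ∃ f : unitInterval → ℝ × ℝ, Continuous f ∧ Function.Injective f ∧ Set.range f = grArc s k ∧
      f 0 = pos s k.lft ∧ f 1 = pos s k.rgt := by
  have hl := lo_lt_hi hn k
  have hc := fn_cont s k
  refine ⟨fun t => (k.lo + t * (k.hi - k.lo), k.fn s (k.lo + t * (k.hi - k.lo))), ?_, ?_, ?_, ?_, ?_⟩
  · fun_prop
  · intro a b hab
    have := congrArg Prod.fst hab
    simp only at this
    ext
    have h0 : (k.hi - k.lo) ≠ 0 := by linarith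
    exact mul_right_cancel₀ h0 (by linarith)
  · ext ⟨x, y⟩
    constructor
    · rintro ⟨t, ht⟩
      obtain ⟨rfl, rfl⟩ := Prod.mk.inj ht
      have := t.2.1
      have := t.2.2
      refine ⟨?_, ?_, rfl⟩ <;> simp only <;> nlinarith
    · rintro ⟨h1, h2, h3⟩
      simp only at h1 h2 h3
      have h0 : 0 < (k.hi - k.lo) := by linarith
      refine ⟨⟨(x - k.lo) / (k.hi - k.lo), div_nonneg (by linarith) h0.le,
        (div_le_one h0).2 (by linarith)⟩, ?_⟩
      have : k.lo + (x - k.lo) / (k.hi - k.lo) * (k.hi - k.lo) = x := by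
        rw [div_mul_cancel₀ _ h0.ne']; ring
      simp only [this, h3]
  · simp [pos_lft]
  · simp [pos_rgt]

/-- The region inside the face. -/
def region (n : ℕ) : Set (ℝ × ℝ) := {p | 0 < p.1 ∧ p.1 < 2 * n ∧ 0 < p.2 ∧ p.2 < p.1 * (2 * n - p.1)}

lemma region_convex (n : ℕ) : Convex ℝ (region n) := by
  rintro ⟨x, y⟩ ⟨h1, h2, h3, h4⟩ ⟨x', y'⟩ ⟨h1', h2', h3', h4'⟩ a b ha hb hab
  simp only at h1 h2 h3 h4 h1' h2' h3' h4'
  obtain rfl : b = 1 - a := by linarith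
  have c1 : ∀ {u v : ℝ}, 0 < u → 0 < v → 0 < a * u + (1 - a) * v := by
    intro u v hu hv
    rcases ha.eq_or_lt with h | h
    · rw [← h]; simpa using hv
    · have := mul_pos h hu
      have := mul_nonneg hb hv.le
      linarith
  refine ⟨?_, ?_, ?_, ?_⟩ <;> simp only [Prod.smul_mk, Prod.mk_add_mk, smul_eq_mul]
  · exact c1 h1 h1'
  · have := c1 (sub_pos.2 h2) (sub_pos.2 h2')
    nlinarith
  · exact c1 h3 h3'
  · have := c1 (sub_pos.2 h4) (sub_pos.2 h4')
    nlinarith [mul_nonneg (mul_nonneg ha hb) (sq_nonneg (x - x'))]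

lemma region_arc {n m : ℕ} (s : Fin n → Bool) (k : CNFEdge n m) {x : ℝ × ℝ}
    (h : x ∈ grArc s k) (hx : x ∈ region n) : False := by
  obtain ⟨r1, r2, r3, r4⟩ := hx
  obtain ⟨h1, h2, h3⟩ := h
  rcases k with k | ⟨i, p, q⟩ | _
  · simp only [CNFEdge.fn] at h3; linarith
  · obtain ⟨b1, b2⟩ := half_bounds h1 h2
    have := half_nonpos (m := m) s (p := p) (q := q) b1 b2
    linarith
  · simp only [CNFEdge.fn] at h3; linarith

lemma region_closure {n : ℕ} {x y : ℝ} (h1 : 0 < x) (h2 : x < 2 * n)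
    (h : y = 0 ∨ y = x * (2 * n - x)) : (x, y) ∈ closure (region n) := by
  have hp : 0 < x * (2 * n - x) := mul_pos h1 (by linarith)
  have hy : y ∈ closure (Ioo 0 (x * (2 * n - x))) := by
    rw [closure_Ioo hp.ne]
    rcases h with rfl | rfl
    · exact ⟨le_rfl, hp.le⟩
    · exact ⟨hp.le, le_rfl⟩
  refine map_mem_closure (f := fun y : ℝ => (x, y)) (by fun_prop) hy ?_
  intro t ht
  exact ⟨h1, h2, ht.1, ht.2⟩

/-- for every selection `s` of one literal vertex from each pair `{x_i, x̄_i}`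
(the set `S = {lit i (s i) : i}`), the graph `G_φ` (with `n ≥ 2`, `m ≥ 1`) has a plane
embedding in which the boundary of a single face contains all the clause vertices
`c_1, …, c_m` and all the vertices in `S`. -/
theorem statement3 (n m : ℕ) (hn : 2 ≤ n) (hm : 1 ≤ m) (s : Fin n → Bool) :
    ∃ Φ : PlaneEmbedding (cnfGraph n m), ∃ F : Set (ℝ × ℝ), Φ.IsFace F ∧
      (∀ j : Fin m, Φ.OnFace F (CNFVtx.cl j)) ∧
      (∀ i : Fin n, Φ.OnFace F (CNFVtx.lit i (s i))) := by
  choose κ hκ using cnf_edge_exists (n := n) (m := m)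
  let Φ : PlaneEmbedding (cnfGraph n m) :=
    { vmap := pos s
      vmap_inj := pos_inj hn s
      arc := fun e => grArc s (κ e)
      arc_path := by
        intro e
        obtain ⟨f, h1, h2, h3, h4, h5⟩ := grArc_path hn s (κ e)
        exact ⟨f, h1, h2, h3, _, _, hκ e, h4, h5⟩
      arc_inter := by
        rintro e e' hne x ⟨h1, h2⟩
        have hne' : κ e ≠ κ e' := by
          intro h
          apply hne
          apply Subtype.ext
          rw [hκ e, hκ e', h]
        obtain ⟨v, rfl⟩ := arc_vtx s hne' h1 h2
        refine ⟨v, ⟨?_, ?_⟩, rfl⟩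
        · rw [hκ e]; exact pos_mem_arc hn s _ _ h1
        · rw [hκ e']; exact pos_mem_arc hn s _ _ h2
      vmap_mem_arc := by
        intro e x h
        rw [hκ e]; exact pos_mem_arc hn s _ _ h }
  have hn0 : (2 : ℝ) ≤ n := by exact_mod_cast hn
  have hreg : region n ⊆ Φ.drawingᶜ := by
    intro x hx hx'
    obtain ⟨e, he⟩ := mem_iUnion.1 hx'
    exact region_arc s (κ e) he hx
  have hp0 : ((1, 1) : ℝ × ℝ) ∈ region n := by
    refine ⟨?_, ?_, ?_, ?_⟩ <;> simp only <;> linarith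
  have hsub : region n ⊆ connectedComponentIn Φ.drawingᶜ (1, 1) :=
    (region_convex n).isPreconnected.subset_connectedComponentIn hp0 hreg
  have hdraw : ∀ v w : CNFVtx n m, (cnfGraph n m).Adj v w → pos s v ∈ Φ.drawing := by
    intro v w h
    refine mem_iUnion.2 ⟨⟨s(v, w), h⟩, ?_⟩
    obtain ⟨f, -, -, h3, a, b, hab, h0, h1⟩ := Φ.arc_path ⟨s(v, w), h⟩
    rw [← h3]
    have : v ∈ s(a, b) := by rw [← hab]; simp
    rcases Sym2.mem_iff.1 this with rfl | rfl
    · exact ⟨0, h0⟩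
    · exact ⟨1, h1⟩
  have hfr : ∀ v w : CNFVtx n m, (cnfGraph n m).Adj v w → pos s v ∈ closure (region n) →
      Φ.OnFace (connectedComponentIn Φ.drawingᶜ (1, 1)) v := by
    intro v w h hc
    refine ⟨closure_mono hsub hc, fun hi => ?_⟩
    exact connectedComponentIn_subset _ _ (interior_subset hi) (hdraw v w h)
  refine ⟨Φ, _, ⟨(1, 1), hreg hp0, rfl⟩, ?_, ?_⟩
  · intro j
    have hc : pos s (CNFVtx.cl j : CNFVtx n m) ∈ closure (region n) := by
      obtain ⟨h1, h2⟩ := cl_bounds hn j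
      exact region_closure h1 h2 (Or.inr rfl)
    rcases Nat.eq_zero_or_pos (j : ℕ) with h0 | h0
    · refine hfr _ (CNFVtx.u 0) ?_ hc
      rw [cnfGraph, SimpleGraph.fromRel_adj]
      exact ⟨by simp, Or.inr (Or.inr (Or.inr (Or.inl ⟨j, h0, rfl, rfl⟩)))⟩
    · refine hfr _ (CNFVtx.cl ⟨j - 1, by omega⟩) ?_ hc
      rw [cnfGraph, SimpleGraph.fromRel_adj]
      refine ⟨?_, Or.inr (Or.inr (Or.inr (Or.inr (Or.inl ⟨_, j, ?_, rfl, rfl⟩))))⟩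
      · intro h
        have := congrArg Fin.val (CNFVtx.cl.inj h)
        simp only at this
        omega
      · simp only; omega
  · intro i
    refine hfr _ (CNFVtx.u i.castSucc) ?_ ?_
    · rw [cnfGraph, SimpleGraph.fromRel_adj]
      exact ⟨by simp, Or.inr (Or.inl ⟨i, s i, rfl, rfl⟩)⟩
    · have := fin_real_lt i
      have h0 : (0 : ℝ) ≤ i := by positivity
      exact region_closure (by linarith) (by linarith) (Or.inl (by simp))
end
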